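/- Let Q be a countable thin quasi-order. Then every countable collection of Q-labeled σ-scattered linear orders, quasi-ordered by labeled embeddability ((L₁,l₁) ≤_emb (L₂,l₂) iff there is a strictly increasing map f : L₁ → L₂ with l₁(x) ≤_Q l₂(f(x)) for all x ∈ L₁), is thin. -/

import Mathlib

/-- The shift map on sequences. -/
def seqShift {Q : Type*} (X : ℕ → Q) : ℕ → Q := fun k => X (k + 1)

/-- The set `Q⃗` of sequences `X` with `¬ r (X k) (X (k+1))` for all `k`. -/
def vecSet {Q : Type*} (r : Q → Q → Prop) : Set (ℕ → Q) :=
  {X | ∀ k, ¬ r (X k) (X (k + 1))}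

/-- The shift graph on a subset `A` of `Qᴺ` (with `Q` discrete, `Qᴺ` carrying the product
Borel structure) admits a Borel proper 3-colouring. -/
def Colour3 {Q : Type*} (A : Set (ℕ → Q)) : Prop :=
  letI : MeasurableSpace Q := ⊤
  ∃ c : A → Fin 3, Measurable c ∧
    ∀ (X : ℕ → Q) (hX : X ∈ A) (hX' : seqShift X ∈ A),
      c ⟨X, hX⟩ ≠ c ⟨seqShift X, hX'⟩

/-- A relation `r` on `Q` is *thin* if the shift graph on `Q⃗ = vecSet r`
is Borel 3-colourable; otherwise it is *thick*. -/
def IsThin {Q : Type*} (r : Q → Q → Prop) : Prop := Colour3 (vecSet r)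

/-- A (pre)ordered type is *scattered* if the rationals do not embed into it. -/
def IsScattered (α : Type*) [Preorder α] : Prop :=
  ¬ ∃ f : ℚ → α, StrictMono f

/-- A linear order is *σ-scattered* if it is a countable union of subsets each of which is
scattered in the induced order. -/
def IsSigmaScattered (α : Type*) [LinearOrder α] : Prop :=
  ∃ A : ℕ → Set α, (∀ x, ∃ n, x ∈ A n) ∧ ∀ n, IsScattered (A n)



namespace TSS

open Set

/-! ### Discretely measurable maps and Borel colourings -/

/-- Countably valued maps all of whose preimages are measurable. -/
def DM {Ω : Type*} [MeasurableSpace Ω] {P : Type*} (φ : Ω → P) : Prop :=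
  (Set.range φ).Countable ∧ ∀ A : Set P, MeasurableSet (φ ⁻¹' A)

section
variable {Ω : Type*} [MeasurableSpace Ω] {P P' : Type*}

lemma DM.comp {φ : Ω → P} (hφ : DM φ) (g : P → P') : DM (fun ω => g (φ ω)) := by
  refine ⟨?_, fun A => hφ.2 (g ⁻¹' A)⟩
  have := hφ.1.image g
  rwa [← Set.range_comp] at this

lemma DM.comp_meas {Ω' : Type*} [MeasurableSpace Ω'] {φ : Ω → P} (hφ : DM φ) {S : Ω' → Ω}
    (hS : Measurable S) : DM (fun ω => φ (S ω)) := by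
  refine ⟨hφ.1.mono ?_, fun A => hS (hφ.2 A)⟩
  rintro _ ⟨x, rfl⟩
  exact ⟨S x, rfl⟩

lemma DM.prod {φ : Ω → P} {ψ : Ω → P'} (hφ : DM φ) (hψ : DM ψ) :
    DM (fun ω => (φ ω, ψ ω)) := by
  have hc := hφ.1.prod hψ.1
  refine ⟨hc.mono ?_, fun A => ?_⟩
  · rintro _ ⟨x, rfl⟩
    exact ⟨⟨x, rfl⟩, ⟨x, rfl⟩⟩
  · have : (fun ω => (φ ω, ψ ω)) ⁻¹' A =
        ⋃ p ∈ (Set.range φ ×ˢ Set.range ψ) ∩ A, (φ ⁻¹' {p.1} ∩ ψ ⁻¹' {p.2}) := by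
      ext ω
      simp only [Set.mem_preimage, Set.mem_iUnion, Set.mem_inter_iff, Set.mem_singleton_iff]
      constructor
      · intro h
        exact ⟨(φ ω, ψ ω), ⟨⟨⟨ω, rfl⟩, ⟨ω, rfl⟩⟩, h⟩, rfl, rfl⟩
      · rintro ⟨⟨p, q⟩, ⟨_, h⟩, h1, h2⟩
        simp only at h1 h2
        rw [h1, h2]; exact h
    rw [this]
    exact MeasurableSet.biUnion (hc.mono Set.inter_subset_left)
      (fun p _ => (hφ.2 _).inter (hψ.2 _))

lemma DM.lim {φ : ℕ → Ω → P} (hφ : ∀ n, DM (φ n)) {N : Ω → ℕ} (hN : Measurable N) :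
    DM (fun ω => φ (N ω) ω) := by
  refine ⟨(Set.countable_iUnion fun n => (hφ n).1).mono ?_, fun A => ?_⟩
  · rintro _ ⟨x, rfl⟩
    exact Set.mem_iUnion.2 ⟨N x, x, rfl⟩
  · have : (fun ω => φ (N ω) ω) ⁻¹' A = ⋃ n, (N ⁻¹' {n} ∩ φ n ⁻¹' A) := by
      ext ω
      simp
    rw [this]
    exact MeasurableSet.iUnion fun n => (hN (MeasurableSet.of_discrete)).inter ((hφ n).2 A)

lemma DM.meas {φ : Ω → P} (hφ : DM φ) (p : P → Prop) : MeasurableSet {ω | p (φ ω)} :=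
  hφ.2 {x | p x}

/-- A Borel 3-colouring of the graph of `S` on `E`. -/
def Col (S : Ω → Ω) (E : Set Ω) : Prop :=
  ∃ c : Ω → Fin 3, Measurable c ∧ ∀ ω ∈ E, c ω ≠ c (S ω)

lemma Col.empty (S : Ω → Ω) {E : Set Ω} (h : ∀ ω, ω ∉ E) : Col S E :=
  ⟨fun _ => 0, measurable_const, fun ω hω => absurd hω (h ω)⟩

lemma Col.of_sub {S : Ω → Ω} {E : Set Ω} (hE : MeasurableSet E) (hinv : ∀ ω ∈ E, S ω ∈ E)
    (h : Col (fun ω : E => (⟨S ω.1, hinv ω.1 ω.2⟩ : E)) Set.univ) : Col S E := by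
  obtain ⟨c, hc, hne⟩ := h
  obtain ⟨g, hg, hgc⟩ := (MeasurableEmbedding.subtype_coe hE).exists_measurable_extend hc
    (fun _ => ⟨0⟩)
  refine ⟨g, hg, fun ω hω => ?_⟩
  have e1 := congrFun hgc ⟨ω, hω⟩
  have e2 := congrFun hgc ⟨S ω, hinv ω hω⟩
  simp only [Function.comp] at e1 e2
  rw [e1, e2]
  exact hne _ trivial

/-- an auxiliary fixed point free map -/
def flip3 (i : Fin 3) : Fin 3 := if i = 0 then 1 else 0

lemma flip3_ne (i : Fin 3) : flip3 i ≠ i := by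
  revert i; decide

open Classical in
lemma Col.sat {S : Ω → Ω} (hS : Measurable S) {E : Set Ω} (hE : MeasurableSet E)
    (hinv : ∀ ω ∈ E, S ω ∈ E) (h : Col S E) : Col S {ω | ∃ n, S^[n] ω ∈ E} := by
  obtain ⟨c, hc, hne⟩ := h
  let p : ℕ → Ω → Prop := fun n ω => S^[n] ω ∈ E ∨ ∀ m, S^[m] ω ∉ E
  have hp : ∀ ω, ∃ n, p n ω := by
    intro ω
    by_cases hh : ∃ n, S^[n] ω ∈ E
    · obtain ⟨n, hn⟩ := hh
      exact ⟨n, Or.inl hn⟩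
    · push Not at hh
      exact ⟨0, Or.inr hh⟩
  have hmeas : ∀ n, MeasurableSet {ω | p n ω} := by
    intro n
    refine MeasurableSet.union ((hS.iterate n) hE) ?_
    have : {ω | ∀ m, S^[m] ω ∉ E} = ⋂ m, (S^[m]) ⁻¹' Eᶜ := by ext; simp
    show MeasurableSet {ω | ∀ m, S^[m] ω ∉ E}
    rw [this]
    exact MeasurableSet.iInter fun m => (hS.iterate m) hE.compl
  refine ⟨fun ω => flip3^[Nat.find (hp ω)] (c (S^[Nat.find (hp ω)] ω)), ?_, ?_⟩
  · refine Measurable.find (f := fun n ω => flip3^[n] (c (S^[n] ω))) ?_ hmeas hp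
    intro n
    exact (Measurable.of_discrete).comp (hc.comp (hS.iterate n))
  · rintro ω ⟨m, hm⟩
    have hsp : S^[Nat.find (hp ω)] ω ∈ E := by
      rcases Nat.find_spec (hp ω) with h | h
      · exact h
      · exact absurd hm (h m)
    by_cases h0 : Nat.find (hp ω) = 0
    · have hω : ω ∈ E := by rw [h0] at hsp; exact hsp
      have h1 : Nat.find (hp (S ω)) = 0 := by
        rw [Nat.find_eq_zero]
        exact Or.inl (hinv ω hω)
      simp only [h0, h1, Function.iterate_zero, id]
      exact hne ω hω
    · obtain ⟨k, hk⟩ := Nat.exists_eq_succ_of_ne_zero h0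
      have h1 : Nat.find (hp (S ω)) = k := by
        rw [Nat.find_eq_iff]
        constructor
        · left
          rw [hk] at hsp
          exact hsp
        · intro j hj
          have := Nat.find_min (hp ω) (m := j + 1) (by omega)
          intro hcon
          apply this
          rcases hcon with hcon | hcon
          · exact Or.inl hcon
          · exact absurd (by rw [hk] at hsp; exact hsp) (hcon k)
      simp only [hk, h1, Function.iterate_succ_apply]
      rw [← Function.iterate_succ_apply, Function.iterate_succ_apply']
      exact flip3_ne _

open Classical in
lemma Col.marker {S : Ω → Ω} (hS : Measurable S) {B : Set Ω} (hB : MeasurableSet B) :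
    Col S {ω | ∀ m, ∃ n, m ≤ n ∧ S^[n] ω ∈ B ∧ S^[n+1] ω ∉ B} := by
  let q : ℕ → Ω → Prop := fun n ω => S^[n] ω ∈ B ∧ S^[n+1] ω ∉ B
  let p : ℕ → Ω → Prop := fun n ω => q n ω ∨ ∀ m, ¬ q m ω
  have hp : ∀ ω, ∃ n, p n ω := by
    intro ω
    by_cases hh : ∃ n, q n ω
    · obtain ⟨n, hn⟩ := hh
      exact ⟨n, Or.inl hn⟩
    · push Not at hh
      exact ⟨0, Or.inr hh⟩
  have hq : ∀ n, MeasurableSet {ω | q n ω} := fun n =>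
    ((hS.iterate n) hB).inter ((hS.iterate (n+1)) hB.compl)
  have hmeas : ∀ n, MeasurableSet {ω | p n ω} := by
    intro n
    refine MeasurableSet.union (hq n) ?_
    have : {ω | ∀ m, ¬ q m ω} = ⋂ m, {ω | q m ω}ᶜ := by ext; simp
    show MeasurableSet {ω | ∀ m, ¬ q m ω}
    rw [this]
    exact MeasurableSet.iInter fun m => (hq m).compl
  let g : ℕ → Fin 3 := fun n => if n = 0 then 2 else if n % 2 = 0 then 0 else 1
  refine ⟨fun ω => g (Nat.find (hp ω)), ?_, ?_⟩
  · exact Measurable.find (f := fun n ω => g n) (fun n => measurable_const) hmeas hp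
  · intro ω hω
    have hw : ∀ ω, (∀ m, ∃ n, m ≤ n ∧ S^[n] ω ∈ B ∧ S^[n+1] ω ∉ B) →
        q (Nat.find (hp ω)) ω := by
      intro ω h
      rcases Nat.find_spec (hp ω) with h' | h'
      · exact h'
      · obtain ⟨n, _, hn⟩ := h 0
        exact absurd hn (h' n)
    have hSω : ∀ m, ∃ n, m ≤ n ∧ S^[n] (S ω) ∈ B ∧ S^[n+1] (S ω) ∉ B := by
      intro m
      obtain ⟨n, hn, h⟩ := hω (m+1)
      obtain ⟨k, rfl⟩ : ∃ k, n = k + 1 := ⟨n - 1, by omega⟩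
      exact ⟨k, by omega, h⟩
    have h1 := hw ω hω
    have h2 := hw (S ω) hSω
    by_cases h0 : Nat.find (hp ω) = 0
    · have h3 : Nat.find (hp (S ω)) ≠ 0 := by
        intro h3
        rw [h3] at h2
        rw [h0] at h1
        exact h1.2 h2.1
      simp only [g, h0, if_true, h3, if_false]
      split <;> decide
    · obtain ⟨k, hk⟩ := Nat.exists_eq_succ_of_ne_zero h0
      have h4 : Nat.find (hp (S ω)) = k := by
        rw [Nat.find_eq_iff]
        constructor
        · left
          rw [hk] at h1
          exact h1
        · intro j hj
          have := Nat.find_min (hp ω) (m := j + 1) (by omega)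
          intro hcon
          apply this
          rcases hcon with hcon | hcon
          · exact Or.inl hcon
          · exact absurd h2 (hcon _)
      simp only [g, hk, h4]
      rcases Nat.even_or_odd' k with ⟨t, rfl | rfl⟩
      · by_cases ht : t = 0
        · subst ht; simp
        · have : (2 * t + 1) % 2 = 1 := by omega
          have h5 : ¬ (2 * t = 0) := by omega
          simp [this, h5]
      · have : (2 * t + 1 + 1) % 2 = 0 := by omega
        have h5 : (2 * t + 1) % 2 = 1 := by omega
        simp [this, h5]

open Classical in
lemma Col.glue {S : Ω → Ω} {E F : Set Ω} (hE : MeasurableSet E)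
    (hinv : ∀ ω, ω ∈ E ↔ S ω ∈ E) (h1 : Col S E) (h2 : Col S F) : Col S (E ∪ F) := by
  obtain ⟨c1, hc1, hn1⟩ := h1
  obtain ⟨c2, hc2, hn2⟩ := h2
  refine ⟨fun ω => if ω ∈ E then c1 ω else c2 ω, Measurable.ite hE hc1 hc2, ?_⟩
  intro ω hω
  by_cases h : ω ∈ E
  · simp only [h, (hinv ω).1 h, if_true]
    exact hn1 ω h
  · have h' : S ω ∉ E := fun h' => h ((hinv ω).2 h')
    simp only [h, h', if_false]
    exact hn2 ω (hω.resolve_left h)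

lemma Col.mono {S : Ω → Ω} {E F : Set Ω} (h : Col S F) (hEF : E ⊆ F) : Col S E := by
  obtain ⟨c, hc, hn⟩ := h
  exact ⟨c, hc, fun ω hω => hn ω (hEF hω)⟩

lemma always_meas {S : Ω → Ω} (hS : Measurable S) {B : Set Ω} (hB : MeasurableSet B) :
    MeasurableSet {ω | ∀ n, S^[n] ω ∈ B} := by
  have : {ω | ∀ n, S^[n] ω ∈ B} = ⋂ n, (S^[n]) ⁻¹' B := by ext; simp
  rw [this]
  exact MeasurableSet.iInter fun n => (hS.iterate n) hB

lemma always_inv {S : Ω → Ω} {B : Set Ω} : ∀ ω ∈ {ω | ∀ n, S^[n] ω ∈ B},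
    S ω ∈ {ω | ∀ n, S^[n] ω ∈ B} := fun _ h n => h (n+1)

lemma sat_meas {S : Ω → Ω} (hS : Measurable S) {E : Set Ω} (hE : MeasurableSet E) :
    MeasurableSet {ω | ∃ n, S^[n] ω ∈ E} := by
  have : {ω | ∃ n, S^[n] ω ∈ E} = ⋃ n, (S^[n]) ⁻¹' E := by ext; simp
  rw [this]
  exact MeasurableSet.iUnion fun n => (hS.iterate n) hE

lemma sat_inv {S : Ω → Ω} {E : Set Ω} (hinv : ∀ ω ∈ E, S ω ∈ E) (ω : Ω) :
    ω ∈ {ω | ∃ n, S^[n] ω ∈ E} ↔ S ω ∈ {ω | ∃ n, S^[n] ω ∈ E} := by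
  constructor
  · rintro ⟨n, hn⟩
    refine ⟨n, ?_⟩
    show S^[n] (S ω) ∈ E
    rw [← Function.iterate_succ_apply, Function.iterate_succ_apply']
    exact hinv _ hn
  · rintro ⟨n, hn⟩
    exact ⟨n+1, hn⟩

theorem Col.switch {S : Ω → Ω} (hS : Measurable S) {B : Set Ω} (hB : MeasurableSet B)
    (h1 : Col S {ω | ∀ n, S^[n] ω ∈ B}) (h0 : Col S {ω | ∀ n, S^[n] ω ∈ Bᶜ}) :
    Col S Set.univ := by
  have m1 := always_meas hS hB
  have m0 := always_meas hS hB.compl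
  have g1 := (h1.sat hS m1 always_inv)
  have g0 := (h0.sat hS m0 always_inv)
  have := Col.glue (sat_meas hS m1) (sat_inv always_inv) g1
    (Col.glue (sat_meas hS m0) (sat_inv always_inv) g0 (Col.marker hS hB))
  refine this.mono ?_
  intro ω _
  by_contra hcon
  simp only [Set.mem_union, Set.mem_ofPred_eq, not_or, not_exists, not_forall] at hcon
  obtain ⟨a, b, m, hm⟩ := hcon
  -- there is n ≥ m in B, then n' ≥ n not in B
  obtain ⟨n, hn⟩ := b m
  rw [← Function.iterate_add_apply] at hn
  have hn' : S^[n + m] ω ∈ B := by simpa using hn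
  obtain ⟨k, hk⟩ := a (n + m)
  rw [← Function.iterate_add_apply] at hk
  have key : ∀ j, S^[j + (n + m)] ω ∈ B := by
    intro j
    induction j with
    | zero => simpa using hn'
    | succ j ih =>
      have := hm (j + (n + m))
      by_contra hcc
      exact this ⟨by omega, ih, by rwa [show j + 1 + (n + m) = j + (n+m) + 1 by ring] at hcc⟩
  exact hk (key k)

end

/-- dynamic form of thinness for countable subcollections -/
def DThin.{v, w} {P : Type w} (r : P → P → Prop) : Prop :=
  ∀ (Ω : Type v) [MeasurableSpace Ω] (S : Ω → Ω), Measurable S → ∀ φ : Ω → P, DM φ →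
    (∀ ω, ¬ r (φ ω) (φ (S ω))) → Col S Set.univ

lemma DThin.of_isThin.{v, w} {Q : Type w} (r : Q → Q → Prop) (h : IsThin r) :
    DThin.{v} r := by
  intro Ω _ S hS φ hφ hbad
  obtain ⟨c, hc, hne⟩ := h
  let _ : MeasurableSpace Q := ⊤
  have hb : ∀ ω, (fun n => φ (S^[n] ω)) ∈ vecSet r := by
    intro ω k
    show ¬ r (φ (S^[k] ω)) (φ (S^[k+1] ω))
    rw [Function.iterate_succ_apply']
    exact hbad _
  refine ⟨fun ω => c ⟨fun n => φ (S^[n] ω), hb ω⟩, ?_, ?_⟩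
  · refine hc.comp (Measurable.subtype_mk ?_)
    rw [measurable_pi_iff]
    intro n A _
    exact (hφ.comp_meas (hS.iterate n)).2 A
  · intro ω _
    exact hne _ (hb ω) (hb (S ω))

/-- restriction of thinness to an invariant set -/
lemma DThin.on.{v, w} {P : Type w} {r : P → P → Prop} (h : DThin.{v} r) {Ω : Type v}
    [MeasurableSpace Ω] {S : Ω → Ω} (hS : Measurable S) {E : Set Ω} (hE : MeasurableSet E)
    (hinv : ∀ ω ∈ E, S ω ∈ E) (φ : Ω → P) (hφ : DM φ)
    (hbad : ∀ ω ∈ E, ¬ r (φ ω) (φ (S ω))) : Col S E := by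
  refine Col.of_sub hE hinv (h E _ ?_ (fun ω => φ ω.1) (hφ.comp_meas measurable_subtype_coe) ?_)
  · exact (hS.comp measurable_subtype_coe).subtype_mk
  · intro ω
    exact hbad ω.1 ω.2

end TSS


namespace TSS

section tree

variable {Ω : Type*} {P Λ : Type*}

open Classical in
/-- One step of the asynchronous descent. -/
noncomputable def stp (S : Ω → Ω) (lr : P → P → Prop) (σ : P → P → P)
    (st : Ω → P × Prop) : Ω → P × Prop := fun ω =>
  (if (¬ (st ω).2 ∧ lr (st ω).1 (st (S ω)).1) then σ (st ω).1 (st (S ω)).1 else (st ω).1,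
   ((¬ (st ω).2 ∧ lr (st ω).1 (st (S ω)).1) ∨ (st ω).2) ∧
     ¬ (¬ (st (S ω)).2 ∧ lr (st (S ω)).1 (st (S (S ω))).1))

/-- The states of the descent. -/
noncomputable def sts (S : Ω → Ω) (lr : P → P → Prop) (σ : P → P → P) (φ : Ω → P) :
    ℕ → Ω → P × Prop
  | 0 => fun ω => (φ ω, False)
  | n+1 => stp S lr σ (sts S lr σ φ n)

end tree

open Classical in
theorem DThin.tree.{v, w, w'} {P : Type w} {Λ : Type w'} (le : P → P → Prop) (lab : P → Λ)
    (lrel : Λ → Λ → Prop) (child : P → P → Prop) (hwf : WellFounded child)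
    (h1 : ∀ h g g', ¬ le h g → child g' g → ¬ le h g')
    (h2 : ∀ h g, ¬ le h g → lrel (lab h) (lab g) →
      ∃ h', child h' h ∧ ∀ g', child g' g → ¬ le h' g')
    (hL : DThin.{v} lrel) : DThin.{v} le := by
  intro Ω _ S hS φ hφ hbad
  let lr : P → P → Prop := fun a b => lrel (lab a) (lab b)
  have h3 : ∀ h g, ∃ h', ¬ le h g → lr h g → child h' h ∧ ∀ g', child g' g → ¬ le h' g' := by
    intro h g
    by_cases hh : ¬ le h g ∧ lr h g
    · obtain ⟨h', hh'⟩ := h2 h g hh.1 hh.2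
      exact ⟨h', fun _ _ => hh'⟩
    · exact ⟨h, fun a b => absurd ⟨a, b⟩ hh⟩
  choose σ hσ using h3
  let x : ℕ → Ω → P := fun s ω => (sts S lr σ φ s ω).1
  let f : ℕ → Ω → Prop := fun s ω => (sts S lr σ φ s ω).2
  let mv : ℕ → Ω → Prop := fun s ω => ¬ f s ω ∧ lr (x s ω) (x s (S ω))
  have xs : ∀ s ω, x (s+1) ω = if mv s ω then σ (x s ω) (x s (S ω)) else x s ω :=
    fun s ω => rfl
  have fs : ∀ s ω, f (s+1) ω = ((mv s ω ∨ f s ω) ∧ ¬ mv s (S ω)) := fun s ω => rfl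
  have f0 : ∀ ω, ¬ f 0 ω := fun ω h => h
  have x0 : ∀ ω, x 0 ω = φ ω := fun ω => rfl
  have hst : ∀ s, DM (sts S lr σ φ s) := by
    intro s
    induction s with
    | zero => exact hφ.comp (fun p => (p, False))
    | succ n ih =>
      have a1 := ih.comp_meas hS
      have a2 := a1.comp_meas hS
      exact (ih.prod (a1.prod a2)).comp (fun t : (P × Prop) × (P × Prop) × (P × Prop) =>
        (if (¬ t.1.2 ∧ lr t.1.1 t.2.1.1) then σ t.1.1 t.2.1.1 else t.1.1,
          ((¬ t.1.2 ∧ lr t.1.1 t.2.1.1) ∨ t.1.2) ∧ ¬ (¬ t.2.1.2 ∧ lr t.2.1.1 t.2.2.1)))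
  have hx : ∀ s, DM (x s) := fun s => (hst s).comp Prod.fst
  have hf : ∀ s, DM (f s) := fun s => (hst s).comp Prod.snd
  have hmv : ∀ s, MeasurableSet {ω | mv s ω} := fun s =>
    ((hf s).prod ((hx s).prod ((hx s).comp_meas hS))).meas
      (fun t => ¬ t.1 ∧ lr t.2.1 t.2.2)
  -- invariants
  have inv : ∀ s ω, (¬ f s ω → ¬ le (x s ω) (x s (S ω))) ∧
      (f s ω → ∀ g', child g' (x s (S ω)) → ¬ le (x s ω) g') := by
    intro s
    induction s with
    | zero => exact fun ω => ⟨fun _ => hbad ω, fun h => absurd h (f0 ω)⟩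
    | succ n ih =>
      have hmove : ∀ ω, mv n ω → child (x (n+1) ω) (x n ω) ∧
          ∀ g', child g' (x n (S ω)) → ¬ le (x (n+1) ω) g' := by
        intro ω hm
        rw [xs, if_pos hm]
        exact hσ _ _ ((ih ω).1 hm.1) hm.2
      have hstay : ∀ ω, ¬ mv n ω → x (n+1) ω = x n ω := by
        intro ω hm
        rw [xs, if_neg hm]
      intro ω
      by_cases m1 : mv n ω <;> by_cases m2 : mv n (S ω)
      · refine ⟨fun _ => (hmove ω m1).2 _ (hmove _ m2).1, fun h => ?_⟩
        rw [fs] at h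
        exact absurd m2 h.2
      · refine ⟨fun h => ?_, fun _ => ?_⟩
        · rw [fs] at h
          exact absurd ⟨Or.inl m1, m2⟩ h
        · rw [hstay _ m2]
          exact (hmove ω m1).2
      · refine ⟨fun _ => ?_, fun h => ?_⟩
        · rw [hstay _ m1]
          by_cases hfn : f n ω
          · exact (ih ω).2 hfn _ (hmove _ m2).1
          · exact h1 _ _ _ ((ih ω).1 hfn) (hmove _ m2).1
        · rw [fs] at h
          exact absurd m2 h.2
      · rw [hstay _ m1, hstay _ m2]
        have : f (n+1) ω = f n ω := by
          rw [fs]; simp [m1, m2]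
        rw [this]
        exact ih ω
  have hchild : ∀ s ω, mv s ω → child (x (s+1) ω) (x s ω) := by
    intro s ω hm
    rw [xs, if_pos hm]
    exact (hσ _ _ ((inv s ω).1 hm.1) hm.2).1
  -- stabilization
  have stab : ∀ ω, ∃ N, ∀ s, N ≤ s → ¬ mv s ω := by
    intro ω
    have key : ∀ p, ∀ s, x s ω = p → ∃ N, ∀ s, N ≤ s → ¬ mv s ω := by
      intro p
      induction p using hwf.induction with
      | _ p ih =>
        intro s hs
        by_cases hm : ∃ t, s ≤ t ∧ mv t ω
        · let t := Nat.find hm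
          have ht := Nat.find_spec hm
          have hconst : ∀ j, s + j ≤ t → x (s + j) ω = p := by
            intro j
            induction j with
            | zero => exact fun _ => hs
            | succ j ihj =>
              intro hj
              have := Nat.find_min hm (m := s + j) (by omega)
              have hn : ¬ mv (s + j) ω := fun hh => this ⟨by omega, hh⟩
              rw [← add_assoc, xs, if_neg hn]
              exact ihj (by omega)
          have hxt : x t ω = p := by
            have := hconst (t - s) (by have := ht.1; omega)
            rwa [show s + (t - s) = t by have := ht.1; omega] at this
          exact ih (x (t+1) ω) (by rw [← hxt]; exact hchild t ω ht.2) (t+1) rfl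
        · push Not at hm
          exact ⟨s, hm⟩
    exact key _ 0 rfl
  let N0 : Ω → ℕ := fun ω => Nat.find (stab ω)
  have hN0 : Measurable N0 := by
    refine measurable_find stab ?_
    intro k
    have : {ω | ∀ s, k ≤ s → ¬ mv s ω} = ⋂ s, ⋂ (_ : k ≤ s), {ω | mv s ω}ᶜ := by
      ext; simp
    rw [this]
    exact MeasurableSet.iInter fun s => MeasurableSet.iInter fun _ => (hmv s).compl
  have N0spec : ∀ ω s, N0 ω ≤ s → ¬ mv s ω := fun ω => Nat.find_spec (stab ω)
  have xconst : ∀ ω j, x (N0 ω + j) ω = x (N0 ω) ω := by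
    intro ω j
    induction j with
    | zero => rfl
    | succ j ih => rw [← add_assoc, xs, if_neg (N0spec ω _ (by omega)), ih]
  let N : Ω → ℕ := fun ω => max (N0 ω) (N0 (S ω))
  have hN : Measurable N := hN0.max (hN0.comp hS)
  let y : Ω → P := fun ω => x (N0 ω) ω
  let F : Ω → Prop := fun ω => f (N ω) ω
  have hy : DM y := DM.lim hx hN0
  have hF : DM F := DM.lim hf hN
  have hyx : ∀ ω s, N0 ω ≤ s → x s ω = y ω := by
    intro ω s hs
    obtain ⟨j, rfl⟩ := Nat.exists_eq_add_of_le hs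
    exact xconst ω j
  refine Col.switch hS (B := {ω | F ω}) (hF.meas id) (Col.empty S ?_) ?_
  · -- all flagged: impossible
    intro ω hω
    have back : ∀ ω s, f s ω → ∃ s' < s, mv s' ω ∧ ∀ t, s' ≤ t → t < s → ¬ mv t (S ω) := by
      intro ω s
      induction s with
      | zero => exact fun h => absurd h (f0 ω)
      | succ n ih =>
        intro h
        rw [fs] at h
        obtain ⟨h | h, h'⟩ := h
        · refine ⟨n, by omega, h, fun t ht ht' => ?_⟩
          have : t = n := by omega
          rw [this]; exact h'
        · obtain ⟨s', hs', hm, hh⟩ := ih h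
          refine ⟨s', by omega, hm, fun t ht ht' => ?_⟩
          by_cases e : t = n
          · rw [e]; exact h'
          · exact hh t ht (by omega)
    have desc : ∀ ω, F ω → N0 (S ω) < N0 ω := by
      intro ω hFω
      obtain ⟨s', hs', hm, hh⟩ := back ω (N ω) hFω
      have a : s' < N0 ω := by
        by_contra hcon
        exact N0spec ω s' (by omega) hm
      refine lt_of_le_of_lt ?_ a
      refine Nat.find_min' (stab (S ω)) ?_
      intro t ht
      by_cases e : t < N ω
      · exact hh t ht e
      · exact N0spec (S ω) t (le_trans (le_max_right _ _) (not_lt.1 e))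
    have bound : ∀ n, N0 (S^[n] ω) + n ≤ N0 ω := by
      intro n
      induction n with
      | zero => simp
      | succ n ih =>
        have := desc (S^[n] ω) (hω n)
        rw [Function.iterate_succ_apply']
        omega
    have := bound (N0 ω + 1)
    omega
  · refine hL.on hS (always_meas hS (MeasurableSet.compl (hF.meas id))) always_inv
      (fun ω => lab (y ω)) (hy.comp lab) ?_
    intro ω hω hl
    have hnf : ¬ f (N ω) ω := hω 0
    have := N0spec ω (N ω) (le_max_left _ _)
    apply this
    refine ⟨hnf, ?_⟩
    rw [hyx ω _ (le_max_left _ _), hyx (S ω) _ (le_max_right _ _)]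
    exact hl

end TSS


namespace TSS

/-! ### The Galvin–Prikry theorem -/

lemma fin_dense {ι : Type*} (T : Finset ι) (Ψ : ι → Set ℕ → Prop)
    (her : ∀ i B B', B' ⊆ B → Ψ i B → Ψ i B')
    (dense : ∀ i A, A.Infinite → ∃ B ⊆ A, B.Infinite ∧ Ψ i B) :
    ∀ A : Set ℕ, A.Infinite → ∃ B ⊆ A, B.Infinite ∧ ∀ i ∈ T, Ψ i B := by
  classical
  induction T using Finset.induction_on with
  | empty => exact fun A hA => ⟨A, subset_rfl, hA, by simp⟩
  | insert i T _ ih =>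
    intro A hA
    obtain ⟨B, hBA, hB, h⟩ := ih A hA
    obtain ⟨B', hB'B, hB', h'⟩ := dense i B hB
    refine ⟨B', hB'B.trans hBA, hB', ?_⟩
    intro j hj
    rcases Finset.mem_insert.1 hj with rfl | hj
    · exact h'
    · exact her j B B' hB'B (h j hj)

lemma inf_tail {A : Set ℕ} (hA : A.Infinite) (s : Finset ℕ) :
    {n ∈ A | ∀ x ∈ s, x < n}.Infinite := by
  have : {n ∈ A | ∀ x ∈ s, x < n} ⊇ A \ ↑(Finset.range (s.sup id + 1)) := by
    rintro n ⟨hn, h⟩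
    refine ⟨hn, fun x hx => ?_⟩
    have : x ≤ s.sup id := Finset.le_sup (f := id) hx
    simp at h
    omega
  exact (hA.sdiff (Finset.finite_toSet _)).mono this

lemma fusion (Φ : Finset ℕ → Set ℕ → Prop)
    (her : ∀ s B B', B' ⊆ B → Φ s B → Φ s B')
    (tail : ∀ s B, Φ s {n ∈ B | ∀ x ∈ s, x < n} → Φ s B)
    (dense : ∀ s A, A.Infinite → ∃ B ⊆ A, B.Infinite ∧ Φ s B) :
    ∀ A : Set ℕ, A.Infinite → ∃ B ⊆ A, B.Infinite ∧ ∀ s : Finset ℕ, ↑s ⊆ B → Φ s B := by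
  intro A hA
  obtain ⟨A0, hA0, hA0i, hΦ0⟩ := dense ∅ A hA
  have step : ∀ B : {B : Set ℕ // B.Infinite}, ∃ B' : {B : Set ℕ // B.Infinite},
      (B'.1 ⊆ B.1 ∧ ∀ n ∈ B'.1, sInf B.1 < n) ∧
      ∀ s ∈ (Finset.range (sInf B.1 + 1)).powerset, Φ s B'.1 := by
    rintro ⟨B, hB⟩
    obtain ⟨B', h1, h2, h3⟩ := fin_dense (Finset.range (sInf B + 1)).powerset Φ her dense
      _ (inf_tail hB {sInf B})
    refine ⟨⟨B', h2⟩, ⟨fun n hn => (h1 hn).1, fun n hn => (h1 hn).2 _ (by simp)⟩, h3⟩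
  choose nx hnx1 hnx2 using step
  let Bs : ℕ → {B : Set ℕ // B.Infinite} := fun k => nx^[k] ⟨A0, hA0i⟩
  have Bs1 : ∀ k, Bs (k+1) = nx (Bs k) := fun k => Function.iterate_succ_apply' _ _ _
  let m : ℕ → ℕ := fun k => sInf (Bs k).1
  have hm : ∀ k, m k ∈ (Bs k).1 := fun k => Nat.sInf_mem (Bs k).2.nonempty
  have hanti : ∀ k j, (Bs (k + j)).1 ⊆ (Bs k).1 := by
    intro k j
    induction j with
    | zero => exact subset_rfl
    | succ j ih =>
      rw [← add_assoc, Bs1]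
      exact (hnx1 (Bs (k+j))).1.trans ih
  have hlt : ∀ k j, m k < m (k + 1 + j) := by
    intro k j
    have h1 := hanti (k+1) j (hm (k+1+j))
    rw [Bs1] at h1
    exact (hnx1 (Bs k)).2 _ h1
  have hmono : StrictMono m := strictMono_nat_of_lt_succ fun k => hlt k 0
  refine ⟨Set.range m, ?_, Set.infinite_range_of_injective hmono.injective, ?_⟩
  · rintro _ ⟨k, rfl⟩
    have := hanti 0 k (by simpa using hm k)
    exact hA0 this
  · intro s hs
    rcases s.eq_empty_or_nonempty with rfl | hne
    · refine her _ _ _ ?_ hΦ0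
      rintro _ ⟨k, rfl⟩
      exact hanti 0 k (by simpa using hm k)
    · obtain ⟨k, hk⟩ := hs (s.max'_mem hne)
      refine tail s _ (her s (Bs (k+1)).1 _ ?_ ?_)
      · rintro _ ⟨⟨j, rfl⟩, hj⟩
        have := hj _ (s.max'_mem hne)
        rw [← hk] at this
        have hkj := hmono.lt_iff_lt.1 this
        obtain ⟨i, rfl⟩ := Nat.exists_eq_add_of_lt hkj
        have := hanti (k+1) i (by simpa [add_right_comm] using hm (k+1+i))
        simpa [add_right_comm] using this
      · rw [Bs1]
        refine hnx2 (Bs k) s ?_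
        rw [Finset.mem_powerset]
        intro x hx
        have h1 := s.le_max' x hx
        rw [← hk] at h1
        simp only [Finset.mem_range]
        have : m k = sInf (Bs k).1 := rfl
        omega

/-- `B` accepts `s`. -/
def Acc' (C : Set (Set ℕ)) (s : Finset ℕ) (B : Set ℕ) : Prop :=
  ∀ Y ⊆ B, Y.Infinite → (∀ y ∈ Y, ∀ x ∈ s, x < y) → (↑s ∪ Y : Set ℕ) ∈ C

/-- Ramsey sets -/
def Ram (C : Set (Set ℕ)) : Prop :=
  ∀ A : Set ℕ, A.Infinite → ∃ B ⊆ A, B.Infinite ∧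
    ((∀ X ⊆ B, X.Infinite → X ∈ C) ∨ (∀ X ⊆ B, X.Infinite → X ∉ C))

lemma Acc'.her {C s B B'} (h : B' ⊆ B) (hA : Acc' C s B) : Acc' C s B' :=
  fun Y hY => hA Y (hY.trans h)

lemma Acc'.tail {C : Set (Set ℕ)} {s : Finset ℕ} {B : Set ℕ}
    (h : Acc' C s {n ∈ B | ∀ x ∈ s, x < n}) : Acc' C s B :=
  fun Y hY hi hs => h Y (fun y hy => ⟨hY hy, hs y hy⟩) hi hs

lemma open_ramsey (C : Set (Set ℕ)) (A : Set ℕ) (hA : A.Infinite)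
    (hopen : ∀ X ⊆ A, X.Infinite → X ∈ C → ∃ s : Finset ℕ, ↑s ⊆ X ∧ Acc' C s X) :
    ∃ B ⊆ A, B.Infinite ∧
    ((∀ X ⊆ B, X.Infinite → X ∈ C) ∨ (∀ X ⊆ B, X.Infinite → X ∉ C)) := by
  classical
  let Rej : Finset ℕ → Set ℕ → Prop := fun s B => ∀ B' ⊆ B, B'.Infinite → ¬ Acc' C s B'
  obtain ⟨B1, hB1A, hB1, hdec⟩ := fusion (fun s B => Acc' C s B ∨ Rej s B)
    (by
      rintro s B B' hB (h | h)
      · exact Or.inl (h.her hB)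
      · exact Or.inr fun B'' hB'' => h B'' (hB''.trans hB))
    (by
      rintro s B (h | h)
      · exact Or.inl h.tail
      · right
        intro B' hB' hi hacc
        refine h {n ∈ B' | ∀ x ∈ s, x < n} ?_ (inf_tail hi s) (hacc.her (fun x hx => hx.1))
        exact fun x hx => ⟨hB' hx.1, hx.2⟩)
    (by
      intro s A hA
      by_cases h : Rej s A
      · exact ⟨A, subset_rfl, hA, Or.inr h⟩
      · simp only [Rej] at h
        push Not at h
        obtain ⟨B', h1, h2, h3⟩ := h
        exact ⟨B', h1, h2, Or.inl h3⟩)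
    A hA
  rcases hdec ∅ (by simp) with hacc | hrej
  · refine ⟨B1, hB1A, hB1, Or.inl fun X hX hXi => ?_⟩
    have := hacc X hX hXi (by simp)
    simpa using this
  obtain ⟨B2, hB2, hB2i, hΦ⟩ := fusion (fun s B => ↑s ⊆ B1 → Rej s B1 → ∀ n ∈ B, n ∈ B1 →
      (∀ x ∈ s, x < n) → Rej (insert n s) B1)
    (by
      intro s B B' hB h h1 h2 n hn
      exact h h1 h2 n (hB hn))
    (by
      intro s B h h1 h2 n hn hn1 hs
      exact h h1 h2 n ⟨hn, hs⟩ hn1 hs)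
    (by
      intro s A' hA'
      let Z : Set ℕ := {n | n ∈ A' ∧ n ∈ B1 ∧ (∀ x ∈ s, x < n) ∧ ¬ Rej (insert n s) B1}
      by_cases hZ : Z.Finite
      · refine ⟨A' \ Z, Set.diff_subset, hA'.diff hZ, ?_⟩
        intro _ _ n hn hn1 hs
        by_contra hcon
        exact hn.2 ⟨hn.1, hn1, hs, hcon⟩
      · refine ⟨A', subset_rfl, hA', ?_⟩
        intro hs1 hrej
        exfalso
        refine hrej Z (fun n hn => hn.2.1) hZ ?_
        intro Y hY hYi hYs
        have hn := Nat.sInf_mem hYi.nonempty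
        set n := sInf Y with hndef
        have hZn := hY hn
        have hsub : (↑(insert n s) : Set ℕ) ⊆ B1 := by
          intro x hx
          simp only [Finset.coe_insert, Set.mem_insert_iff] at hx
          rcases hx with rfl | hx
          · exact hZn.2.1
          · exact hs1 hx
        have hacc : Acc' C (insert n s) B1 := (hdec _ hsub).resolve_right hZn.2.2.2
        have := hacc (Y \ {n}) (fun y hy => (hY hy.1).2.1)
          (hYi.diff (Set.finite_singleton n)) (by
            intro y hy x hx
            rcases Finset.mem_insert.1 hx with rfl | hx
            · have h1 : sInf Y ≤ y := Nat.sInf_le hy.1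
              have h2 : y ≠ sInf Y := hy.2
              omega
            · exact hYs y hy.1 x hx)
        convert this using 1
        ext x
        simp only [Set.mem_union, Finset.mem_coe, Finset.mem_insert, Set.mem_diff,
          Set.mem_singleton_iff]
        constructor
        · rintro (h | h)
          · exact Or.inl (Or.inr h)
          · by_cases e : x = n
            · exact Or.inl (Or.inl e)
            · exact Or.inr ⟨h, e⟩
        · rintro ((h | h) | h)
          · rw [h]; exact Or.inr hn
          · exact Or.inl h
          · exact Or.inr h.1)
    B1 hB1
  have hall : ∀ s : Finset ℕ, ↑s ⊆ B2 → Rej s B1 := by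
    intro s
    induction s using Finset.induction_on_max with
    | empty => exact fun _ => hrej
    | insert a s ha ih =>
      intro hs
      have hs' : (↑s : Set ℕ) ⊆ B2 := fun x hx => hs (by simp [Finset.mem_coe.1 hx])
      have ha2 : a ∈ B2 := hs (by simp)
      exact hΦ s hs' (hs'.trans hB2) (ih hs') a ha2 (hB2 ha2) ha
  refine ⟨B2, hB2.trans hB1A, hB2i, Or.inr fun X hX hXi hXC => ?_⟩
  obtain ⟨s, hsX, hacc⟩ := hopen X (hX.trans (hB2.trans hB1A)) hXi hXC
  exact hall s (hsX.trans hX) X (hX.trans hB2) hXi hacc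

/-- translate -/
def tr (s : Finset ℕ) (C : Set (Set ℕ)) : Set (Set ℕ) := {Y | (↑s ∪ Y : Set ℕ) ∈ C}

/-- completely Ramsey sets -/
def CR (C : Set (Set ℕ)) : Prop := ∀ s, Ram (tr s C)

lemma CR.compl {C} (h : CR C) : CR Cᶜ := by
  intro s A hA
  obtain ⟨B, h1, h2, h3⟩ := h s A hA
  refine ⟨B, h1, h2, ?_⟩
  rcases h3 with h3 | h3
  · exact Or.inr fun X hX hi hc => hc (h3 X hX hi)
  · exact Or.inl fun X hX hi => h3 X hX hi

lemma CR.tr {C} (h : CR C) (s : Finset ℕ) : CR (tr s C) := by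
  classical
  intro t
  have : TSS.tr t (TSS.tr s C) = TSS.tr (s ∪ t) C := by
    ext Y
    simp [TSS.tr, Set.union_assoc]
  rw [this]
  exact h _

lemma ram_iUnion (C : ℕ → Set (Set ℕ)) (h : ∀ n, CR (C n)) : Ram (⋃ n, C n) := by
  classical
  intro A hA
  let Ψ : Finset ℕ → ℕ → Set ℕ → Prop := fun s n B =>
    Acc' (C n) s B ∨ Acc' (C n)ᶜ s B
  obtain ⟨B0, hB0A, hB0, hΦ⟩ := fusion (fun s B => ∀ n ∈ Finset.range (s.sup id + 1), Ψ s n B)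
    (by
      intro s B B' hB hh n hn
      rcases hh n hn with hh | hh
      · exact Or.inl (hh.her hB)
      · exact Or.inr (hh.her hB))
    (by
      intro s B hh n hn
      rcases hh n hn with hh | hh
      · exact Or.inl hh.tail
      · exact Or.inr hh.tail)
    (by
      intro s A hA
      refine fin_dense _ (Ψ s) ?_ ?_ A hA
      · intro n B B' hB hh
        rcases hh with hh | hh
        · exact Or.inl (hh.her hB)
        · exact Or.inr (hh.her hB)
      · intro n A hA
        obtain ⟨B, h1, h2, h3⟩ := h n s A hA
        refine ⟨B, h1, h2, ?_⟩
        rcases h3 with h3 | h3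
        · exact Or.inl fun Y hY hi _ => h3 Y hY hi
        · exact Or.inr fun Y hY hi _ => h3 Y hY hi)
    A hA
  obtain ⟨B, h1, h2, h3⟩ := open_ramsey (⋃ n, C n) B0 hB0 (by
    intro X hX hXi hXC
    obtain ⟨n, hn⟩ := Set.mem_iUnion.1 hXC
    obtain ⟨m, hmX, hnm⟩ := hXi.exists_gt n
    let s : Finset ℕ := (Finset.range (m+1)).filter (· ∈ X)
    have hsX : (↑s : Set ℕ) ⊆ X := by
      intro x hx
      exact (Finset.mem_filter.1 (Finset.mem_coe.1 hx)).2
    have hms : m ∈ s := by simp [s, hmX]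
    have hle : m ≤ s.sup id := Finset.le_sup (f := id) hms
    refine ⟨s, hsX, ?_⟩
    rcases hΦ s (hsX.trans hX) n (by simp; omega) with hh | hh
    · exact fun Y hY hi hs => Set.mem_iUnion.2 ⟨n, hh Y (hY.trans hX) hi hs⟩
    · exfalso
      refine hh (X \ ↑s) (Set.diff_subset.trans hX) (hXi.diff s.finite_toSet) ?_ ?_
      · rintro y ⟨hy, hys⟩ x hx
        simp only [s, Finset.coe_filter, Set.mem_ofPred_eq, not_and, Finset.mem_range] at hys
        have hx' := Finset.mem_range.1 (Finset.mem_filter.1 hx).1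
        have : ¬ y < m + 1 := fun hlt => hys hlt hy
        omega
      · rw [Set.union_diff_cancel hsX]
        exact hn)
  exact ⟨B, h1.trans hB0A, h2, h3⟩

lemma CR.iUnion (C : ℕ → Set (Set ℕ)) (h : ∀ n, CR (C n)) : CR (⋃ n, C n) := by
  intro s
  have : TSS.tr s (⋃ n, C n) = ⋃ n, TSS.tr s (C n) := by
    ext Y; simp [TSS.tr]
  rw [this]
  exact ram_iUnion _ fun n => (h n).tr s

/-- completely Ramsey sets as a σ-algebra -/
def CRms : MeasurableSpace (Set ℕ) where
  MeasurableSet' := CR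
  measurableSet_empty := by
    intro s A hA
    exact ⟨A, subset_rfl, hA, Or.inr fun X _ _ h => h⟩
  measurableSet_compl := fun _ h => h.compl
  measurableSet_iUnion := fun C h => CR.iUnion C h

lemma CR_mem (n : ℕ) : CR {X | n ∈ X} := by
  intro s A hA
  by_cases hn : n ∈ s
  · exact ⟨A, subset_rfl, hA, Or.inl fun X _ _ => Or.inl hn⟩
  · refine ⟨A \ {n}, Set.diff_subset, hA.sdiff (Set.finite_singleton n), Or.inr ?_⟩
    rintro X hX _ (h | h)
    · exact hn h
    · exact (hX h).2 rfl

lemma CR_of_measurable {C : Set (Set ℕ)} (hC : MeasurableSet C) : CR C := by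
  have : @Measurable (Set ℕ) (Set ℕ) CRms _ id := by
    rw [@measurable_set_iff]
    intro n
    exact @measurableSet_setOf _ CRms _ |>.1 (CR_mem n)
  exact this hC

/-- the space of infinite subsets -/
abbrev IS := {A : Set ℕ // A.Infinite}

/-- removing the minimum -/
noncomputable def isShift (A : IS) : IS := ⟨A.1 \ {sInf A.1}, A.2.diff (Set.finite_singleton _)⟩

lemma sInf_meas (n : ℕ) : MeasurableSet {A : IS | sInf A.1 = n} := by
  have : {A : IS | sInf A.1 = n} =
      {A : IS | n ∈ A.1} ∩ ⋂ m, ⋂ (_ : m < n), {A : IS | m ∈ A.1}ᶜ := by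
    ext A
    simp only [Set.mem_ofPred_eq, Set.mem_inter_iff, Set.mem_iInter, Set.mem_compl_iff]
    constructor
    · rintro rfl
      exact ⟨Nat.sInf_mem A.2.nonempty, fun m hm => Nat.notMem_of_lt_sInf hm⟩
    · rintro ⟨h1, h2⟩
      refine le_antisymm (Nat.sInf_le h1) ?_
      by_contra hcon
      exact h2 _ (not_le.1 hcon) (Nat.sInf_mem A.2.nonempty)
  have hm : ∀ m, MeasurableSet {A : IS | m ∈ A.1} := fun m =>
    measurable_subtype_coe (measurableSet_setOf.2 (measurable_set_mem m))
  rw [this]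
  exact (hm n).inter (MeasurableSet.iInter fun m => MeasurableSet.iInter fun _ => (hm m).compl)

lemma isShift_meas : Measurable isShift := by
  refine Measurable.subtype_mk ?_
  rw [measurable_set_iff]
  intro n
  refine measurableSet_setOf.1 ?_
  have : {A : IS | n ∈ A.1 \ {sInf A.1}} = {A : IS | n ∈ A.1} ∩ {A : IS | sInf A.1 = n}ᶜ := by
    ext A
    simp [eq_comm]
  rw [this]
  exact (measurable_subtype_coe (measurableSet_setOf.2 (measurable_set_mem n))).inter
    (sInf_meas n).compl

theorem no_col : ¬ Col isShift Set.univ := by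
  rintro ⟨c, hc, hne⟩
  have key : ∀ i : Fin 3, ∀ A : Set ℕ, A.Infinite → ∃ B ⊆ A, B.Infinite ∧
      ((∀ X : IS, X.1 ⊆ B → c X = i) ∨ (∀ X : IS, X.1 ⊆ B → c X ≠ i)) := by
    intro i A hA
    obtain ⟨C, hC, hCi⟩ : MeasurableSet (c ⁻¹' {i}) := hc (MeasurableSet.singleton i)
    obtain ⟨B, h1, h2, h3⟩ := CR_of_measurable hC ∅ A hA
    refine ⟨B, h1, h2, ?_⟩
    have hmem : ∀ X : IS, X.1 ∈ TSS.tr ∅ C ↔ c X = i := by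
      intro X
      have : X ∈ Subtype.val ⁻¹' C ↔ X ∈ c ⁻¹' {i} := by rw [hCi]
      simpa [TSS.tr] using this
    rcases h3 with h3 | h3
    · exact Or.inl fun X hX => (hmem X).1 (h3 X.1 hX X.2)
    · exact Or.inr fun X hX he => h3 X.1 hX X.2 ((hmem X).2 he)
  have fin : ∀ B : Set ℕ, B.Infinite → ∀ i, ¬ (∀ X : IS, X.1 ⊆ B → c X = i) := by
    intro B hB i h
    refine hne ⟨B, hB⟩ trivial ?_
    rw [h ⟨B, hB⟩ subset_rfl, h (isShift ⟨B, hB⟩) Set.diff_subset]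
  obtain ⟨B0, -, i0, h0⟩ := key 0 Set.univ Set.infinite_univ
  obtain ⟨B1, s1, i1, h1⟩ := key 1 B0 i0
  obtain ⟨B2, s2, i2, h2⟩ := key 2 B1 i1
  have h0 := h0.resolve_left (fin _ i0 0)
  have h1 := h1.resolve_left (fin _ i1 1)
  have h2 := h2.resolve_left (fin _ i2 2)
  have a := h0 ⟨B2, i2⟩ (s2.trans s1)
  have b := h1 ⟨B2, i2⟩ s2
  have d := h2 ⟨B2, i2⟩ subset_rfl
  generalize c ⟨B2, i2⟩ = j at a b d
  fin_cases j <;> simp_all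

/-- thin relations have no bad sequences -/
theorem DThin.wqo.{w} {P : Type w} {r : P → P → Prop} (h : DThin.{0} r) (e : ℕ → P) :
    ∃ m n, m < n ∧ r (e m) (e n) := by
  by_contra hcon
  push Not at hcon
  refine no_col (h IS isShift isShift_meas (fun A => e (sInf A.1)) ?_ ?_)
  · have : DM (fun A : IS => sInf A.1) := by
      refine ⟨Set.to_countable _, fun T => ?_⟩
      have : (fun A : IS => sInf A.1) ⁻¹' T = ⋃ n ∈ T, {A : IS | sInf A.1 = n} := by
        ext A; simp
      rw [this]
      exact MeasurableSet.biUnion (Set.to_countable _) fun n _ => sInf_meas n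
    exact this.comp e
  · intro A
    refine hcon _ _ ?_
    have h1 := Nat.sInf_mem (isShift A).2.nonempty
    have h2 : sInf (isShift A).1 ∈ A.1 \ {sInf A.1} := h1
    have h3 : sInf A.1 ≤ sInf (isShift A).1 := Nat.sInf_le h2.1
    exact lt_of_le_of_ne h3 (fun e => h2.2 e.symm)

end TSS


namespace TSS

/-! ### Codes -/

lemma DThin.wf.{v, w} {P : Type w} [LinearOrder P] [WellFoundedLT P] :
    DThin.{v} (fun a b : P => a ≤ b) := by
  intro Ω _ S hS φ hφ hbad
  refine Col.empty S fun ω _ => ?_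
  have : ∀ p : P, ∀ ω, φ ω ≠ p := by
    intro p
    induction p using WellFoundedLT.induction with
    | ind p ih =>
      rintro ω rfl
      exact ih _ (not_le.1 (hbad ω)) (S ω) rfl
  exact this _ ω rfl

lemma DThin.fin3.{v} : DThin.{v} (fun a b : Fin 3 => a = b) := by
  intro Ω _ S hS φ hφ hbad
  exact ⟨φ, fun A _ => hφ.2 A, fun ω _ => hbad ω⟩

lemma DThin.prod.{v, w, w'} {P : Type w} {P' : Type w'} {r : P → P → Prop} {s : P' → P' → Prop}
    (hr : DThin.{v} r) (hs : DThin.{v} s) :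
    DThin.{v} (fun a b : P × P' => r a.1 b.1 ∧ s a.2 b.2) := by
  intro Ω _ S hS φ hφ hbad
  have hB : MeasurableSet {ω | ¬ r (φ ω).1 (φ (S ω)).1} :=
    (hφ.prod (hφ.comp_meas hS)).meas (fun t => ¬ r t.1.1 t.2.1)
  refine Col.switch hS hB ?_ ?_
  · exact hr.on hS (always_meas hS hB) always_inv (fun ω => (φ ω).1) (hφ.comp Prod.fst)
      (fun ω h => h 0)
  · refine hs.on hS (always_meas hS hB.compl) always_inv (fun ω => (φ ω).2) (hφ.comp Prod.snd)
      (fun ω h h' => hbad ω ⟨?_, h'⟩)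
    have := h 0
    simpa using this

lemma DThin.sum.{v, w, w'} {P : Type w} {P' : Type w'} {r : P → P → Prop} {s : P' → P' → Prop}
    (hr : DThin.{v} r) (hs : DThin.{v} s) :
    DThin.{v} (Sum.LiftRel r s) := by
  intro Ω _ S hS φ hφ hbad
  have hB : MeasurableSet {ω | (φ ω).isLeft = true} := hφ.meas (fun t => t.isLeft = true)
  refine Col.switch hS hB ?_ ?_
  · by_cases hP : Nonempty P
    · obtain ⟨p⟩ := hP
      refine hr.on hS (always_meas hS hB) always_inv (fun ω => Sum.elim id (fun _ => p) (φ ω))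
        (hφ.comp _) (fun ω h h' => ?_)
      obtain ⟨a, ha⟩ := Sum.isLeft_iff.1 (h 0)
      obtain ⟨b, hb⟩ := Sum.isLeft_iff.1 (h 1)
      refine hbad ω ?_
      simp only [Function.iterate_zero, Function.iterate_one, id] at ha hb
      rw [ha, hb] at h' ⊢
      exact Sum.LiftRel.inl h'
    · refine Col.empty S fun ω h => ?_
      obtain ⟨a, ha⟩ := Sum.isLeft_iff.1 (h 0)
      exact hP ⟨a⟩
  · have hh : ∀ ω : Ω, ω ∈ ({ω | (φ ω).isLeft = true} : Set Ω)ᶜ → ∃ y, φ ω = Sum.inr y := by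
      intro ω h
      have : ¬ ((φ ω).isLeft = true) := h
      apply Sum.isRight_iff.1
      simpa using this
    by_cases hP : Nonempty P'
    · obtain ⟨p⟩ := hP
      refine hs.on hS (always_meas hS hB.compl) always_inv
        (fun ω => Sum.elim (fun _ => p) id (φ ω)) (hφ.comp _) (fun ω h h' => ?_)
      obtain ⟨a, ha⟩ := hh _ (h 0)
      obtain ⟨b, hb⟩ := hh _ (h 1)
      refine hbad ω ?_
      simp only [Function.iterate_zero, Function.iterate_one, id] at ha hb
      rw [ha, hb] at h' ⊢
      exact Sum.LiftRel.inr h'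
    · refine Col.empty S fun ω h => ?_
      obtain ⟨a, ha⟩ := hh _ (h 0)
      exact hP ⟨a⟩

/-- Codes for labelled linear orders. -/
inductive Code.{u} (Q : Type u) : Type (max u 1)
  | leaf (q : Q) : Code Q
  | node (k : Fin 3) (a b : Ordinal.{0}) (ι : Type) (f : ι → Code Q) : Code Q

/-- The quasi-order on codes. -/
inductive Le.{u} {Q : Type u} (r : Q → Q → Prop) : Code Q → Code Q → Prop
  | leaf {p q : Q} (h : r p q) : Le r (.leaf p) (.leaf q)
  | into {h : Code Q} {k a b ι} {g : ι → Code Q} (j : ι) (hj : Le r h (g j)) :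
      Le r h (.node k a b ι g)
  | node {k a b a' b' ι ι'} {f : ι → Code Q} {g : ι' → Code Q} (ha : a ≤ a') (hb : b ≤ b')
      (w : ι → ι') (hw : ∀ i, Le r (f i) (g (w i))) :
      Le r (.node k a b ι f) (.node k a' b' ι' g)

universe u

variable {Q : Type u} {r : Q → Q → Prop}

lemma Le.trans (ht : Transitive r) {x y z : Code Q} (hxy : Le r x y) (hyz : Le r y z) :
    Le r x z := by
  induction hyz generalizing x with
  | leaf h =>
    cases hxy with
    | leaf h' => exact .leaf (ht h' h)
  | into j _ ih => exact .into j (ih hxy)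
  | node ha hb w hw ih =>
    cases hxy with
    | into j hj => exact .into (w j) (ih j hj)
    | node ha' hb' w' hw' =>
      exact .node (ha'.trans ha) (hb'.trans hb) (fun i => w (w' i)) (fun i => ih _ (hw' i))

lemma Le.refl (hr : Reflexive r) (x : Code Q) : Le r x x := by
  induction x with
  | leaf q => exact .leaf (hr q)
  | node k a b ι f ih => exact .node le_rfl le_rfl id ih

/-- Immediate children -/
inductive Child : Code Q → Code Q → Prop
  | mk {k a b ι} (f : ι → Code Q) (i : ι) : Child (f i) (.node k a b ι f)

lemma child_wf : WellFounded (Child (Q := Q)) := by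
  constructor
  intro x
  induction x with
  | leaf q => exact ⟨_, fun y h => by cases h⟩
  | node k a b ι f ih => exact ⟨_, fun y h => by cases h; exact ih _⟩

/-- The label of a code -/
def clab : Code Q → Q ⊕ (Fin 3 × Ordinal.{0} × Ordinal.{0})
  | .leaf q => .inl q
  | .node k a b _ _ => .inr (k, a, b)

theorem DThin.le.{v} (hQ : DThin.{v} r) : DThin.{v} (Le r) := by
  have hL : DThin.{v} (Sum.LiftRel r (fun x y : Fin 3 × Ordinal.{0} × Ordinal.{0} =>
      x.1 = y.1 ∧ x.2.1 ≤ y.2.1 ∧ x.2.2 ≤ y.2.2)) :=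
    hQ.sum (DThin.fin3.prod (DThin.wf.prod DThin.wf))
  refine DThin.tree (Le r) clab _ Child child_wf ?_ ?_ hL
  · rintro h g g' hn ⟨f, i⟩ hle
    exact hn (.into i hle)
  · intro h g hn hl
    cases h with
    | leaf p =>
      cases g with
      | leaf q =>
        exact absurd (Le.leaf (Sum.liftRel_inl_inl.1 hl)) hn
      | node => exact absurd hl Sum.not_liftRel_inl_inr
    | node k a b ι f =>
      cases g with
      | leaf q => exact absurd hl Sum.not_liftRel_inr_inl
      | node k' a' b' ι' g =>
        obtain ⟨e, ha, hb⟩ := Sum.liftRel_inr_inr.1 hl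
        simp only at e ha hb
        subst e
        by_contra hcon
        push Not at hcon
        apply hn
        have : ∀ i, ∃ j, Le r (f i) (g j) := by
          intro i
          obtain ⟨g', hg', hle⟩ := hcon (f i) (.mk f i)
          cases hg' with
          | mk _ j => exact ⟨j, hle⟩
        choose w hw using this
        exact .node ha hb w hw

/-- head comparison for lists -/
def hrel {P : Type*} (r : P → P → Prop) : Option P → Option P → Prop
  | none, _ => True
  | some _, none => False
  | some a, some b => r a b

lemma DThin.hrel.{v, w} {P : Type w} {r : P → P → Prop} (h : DThin.{v} r) :
    DThin.{v} (hrel r) := by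
  intro Ω _ S hS φ hφ hbad
  have h1 : ∀ ω, ∃ p, φ ω = some p := by
    intro ω
    cases hh : φ ω with
    | none => exact absurd (by rw [hh]; trivial) (hbad ω)
    | some a => exact ⟨a, rfl⟩
  by_cases hO : Nonempty Ω
  · obtain ⟨p, -⟩ := h1 hO.some
    refine h Ω S hS (fun ω => (φ ω).getD p) (hφ.comp (fun o : Option P => o.getD p)) fun ω hr => hbad ω ?_
    obtain ⟨a, ha⟩ := h1 ω
    obtain ⟨b, hb⟩ := h1 (S ω)
    simp only [ha, hb] at hr ⊢
    exact hr
  · exact Col.empty S fun ω => absurd ⟨ω⟩ hO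

theorem DThin.list.{v, w} {P : Type w} {r : P → P → Prop} (h : DThin.{v} r) :
    DThin.{v} (List.SublistForall₂ r) := by
  refine DThin.tree (List.SublistForall₂ r) List.head? (TSS.hrel r)
    (fun s t => ∃ a, t = a :: s) ?_ ?_ ?_ h.hrel
  · constructor
    intro l
    induction l with
    | nil => exact ⟨_, by rintro y ⟨a, ha⟩; cases ha⟩
    | cons a l ih => exact ⟨_, by rintro y ⟨a, ha⟩; cases ha; exact ih⟩
  · rintro s t t' hn ⟨a, rfl⟩ hle
    exact hn (.cons_right hle)
  · intro s t hn hl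
    cases s with
    | nil => exact absurd .nil hn
    | cons a s =>
      cases t with
      | nil => exact absurd hl id
      | cons b t =>
        refine ⟨s, ⟨a, rfl⟩, ?_⟩
        rintro t' ⟨c, hc⟩ hle
        cases hc
        exact hn (.cons hl hle)

end TSS


namespace TSS

/-- The reversed linear order on the same type -/
abbrev dualLO {α : Type*} (i : LinearOrder α) : LinearOrder α := @OrderDual.instLinearOrder α i

/-- `A` lies entirely below `B`. -/
def LL {α : Type*} [LinearOrder α] (A B : Set α) : Prop := ∀ x ∈ A, ∀ y ∈ B, x < y

/-- chains of nonempty sets -/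
structure Ch {α : Type*} [LinearOrder α] (𝓑 : Set (Set α)) : Prop where
  ne : ∀ B ∈ 𝓑, B.Nonempty
  tot : ∀ B ∈ 𝓑, ∀ B' ∈ 𝓑, B = B' ∨ LL B B' ∨ LL B' B

section basic

variable {α : Type*} [LinearOrder α] {β : Type*} [LinearOrder β]

lemma LL.mono {A B A' B' : Set α} (h : LL A B) (hA : A' ⊆ A) (hB : B' ⊆ B) : LL A' B' :=
  fun x hx y hy => h x (hA hx) y (hB hy)

lemma LL.irrefl {A : Set α} (hA : A.Nonempty) : ¬ LL A A := fun h => by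
  obtain ⟨x, hx⟩ := hA
  exact lt_irrefl _ (h x hx x hx)

lemma LL.trans {A B C : Set α} (hB : B.Nonempty) (h : LL A B) (h' : LL B C) : LL A C := by
  obtain ⟨y, hy⟩ := hB
  exact fun x hx z hz => (h x hx y hy).trans (h' y hy z hz)

lemma LL.asymm {A B : Set α} (hA : A.Nonempty) (hB : B.Nonempty) (h : LL A B) : ¬ LL B A :=
  fun h' => LL.irrefl hA (h.trans hB h')

lemma LL.dual {A B : Set α} : @LL α (dualLO ‹_›) A B ↔ LL B A :=
  ⟨fun h x hx y hy => h y hy x hx, fun h x hx y hy => h y hy x hx⟩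

lemma Ch.dual {𝓑 : Set (Set α)} (h : Ch 𝓑) : @Ch α (dualLO ‹_›) 𝓑 :=
  @Ch.mk α (dualLO ‹_›) 𝓑 h.ne (fun B hB B' hB' => by
    rcases h.tot B hB B' hB' with h | h | h
    · exact Or.inl h
    · exact Or.inr (Or.inr (LL.dual.2 h))
    · exact Or.inr (Or.inl (LL.dual.2 h)))

lemma Ch.mono {𝓑 𝓑' : Set (Set α)} (h : Ch 𝓑) (hs : 𝓑' ⊆ 𝓑) : Ch 𝓑' :=
  ⟨fun B hB => h.ne B (hs hB), fun B hB B' hB' => h.tot B (hs hB) B' (hs hB')⟩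

def El {α : Type*} (𝓑 : Set (Set α)) : Type _ := {B : Set α // B ∈ 𝓑}

open Classical in
/-- The linear order of a chain -/
@[reducible] noncomputable def Ch.lo {𝓑 : Set (Set α)} (h : Ch 𝓑) : LinearOrder (El 𝓑) where
  le B B' := B = B' ∨ LL B.1 B'.1
  lt B B' := LL B.1 B'.1
  le_refl B := Or.inl rfl
  le_trans A B C := by
    rintro (rfl | h1) (rfl | h2)
    · exact Or.inl rfl
    · exact Or.inr h2
    · exact Or.inr h1
    · exact Or.inr (h1.trans (h.ne _ B.2) h2)
  lt_iff_le_not_ge A B := by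
    constructor
    · intro h1
      refine ⟨Or.inr h1, ?_⟩
      rintro (rfl | h2)
      · exact LL.irrefl (h.ne _ B.2) h1
      · exact LL.asymm (h.ne _ A.2) (h.ne _ B.2) h1 h2
    · rintro ⟨rfl | h1, h2⟩
      · exact absurd (Or.inl rfl) h2
      · exact h1
  le_antisymm A B := by
    rintro (rfl | h1) (h2 | h2)
    · rfl
    · rfl
    · exact h2.symm
    · exact absurd h2 (LL.asymm (h.ne _ A.2) (h.ne _ B.2) h1)
  le_total A B := by
    rcases h.tot A.1 A.2 B.1 B.2 with h | h | h
    · exact Or.inl (Or.inl (Subtype.ext h))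
    · exact Or.inl (Or.inr h)
    · exact Or.inr (Or.inr h)
  toDecidableLE := Classical.decRel _

/-- labelled embeddings of a set into a set -/
def Emb (R : α → β → Prop) (A : Set α) (B : Set β) : Prop :=
  ∃ f : A → β, (∀ x, f x ∈ B ∧ R x.1 (f x)) ∧ ∀ x y : A, x.1 < y.1 → f x < f y

lemma Emb.mono {R : α → β → Prop} {A : Set α} {B B' : Set β} (h : Emb R A B) (hB : B ⊆ B') :
    Emb R A B' := by
  obtain ⟨f, h1, h2⟩ := h
  exact ⟨f, fun x => ⟨hB (h1 x).1, (h1 x).2⟩, h2⟩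

lemma Emb.empty (R : α → β → Prop) (B : Set β) : Emb R ∅ B :=
  ⟨fun x => x.2.elim, fun x => x.2.elim, fun x => x.2.elim⟩

lemma Emb.dual {R : α → β → Prop} {A : Set α} {B : Set β} :
    @Emb α (dualLO ‹_›) β (dualLO ‹_›) R A B ↔ Emb R A B := by
  constructor
  · rintro ⟨f, h1, h2⟩
    exact ⟨f, h1, fun x y h => h2 y x h⟩
  · rintro ⟨f, h1, h2⟩
    exact ⟨f, h1, fun x y h => h2 y x h⟩

/-- gluing embeddings along an ordered family -/
lemma Emb.glue {I : Type*} [LinearOrder I] {R : α → β → Prop} (C : I → Set α) (B' : I → Set β)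
    {A : Set α} {B : Set β} (hA : A ⊆ ⋃ i, C i) (hC : ∀ i j, i < j → LL (C i) (C j))
    (hB : ∀ i, B' i ⊆ B) (hB' : ∀ i j, i < j → LL (B' i) (B' j))
    (h : ∀ i, Emb R (C i) (B' i)) : Emb R A B := by
  choose f h1 h2 using h
  have hx : ∀ x : A, ∃ i, x.1 ∈ C i := fun x => by simpa using hA x.2
  choose d hd using hx
  refine ⟨fun x => f (d x) ⟨x.1, hd x⟩, fun x => ⟨hB _ (h1 _ _).1, (h1 (d x) ⟨x.1, hd x⟩).2⟩, ?_⟩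
  intro x y hxy
  rcases lt_trichotomy (d x) (d y) with h | h | h
  · exact hB' _ _ h _ (h1 _ _).1 _ (h1 _ _).1
  · have : ∀ i (hi : x.1 ∈ C i), i = d y → f i ⟨x.1, hi⟩ < f (d y) ⟨y.1, hd y⟩ := by
      rintro i hi rfl
      exact h2 _ _ _ hxy
    exact this _ _ h
  · exact absurd (hC _ _ h _ (hd y) _ (hd x)) (not_lt.2 hxy.le)

lemma Emb.union {R : α → β → Prop} {A A' : Set α} {B B' : Set β} (hA : LL A A') (hB : LL B B')
    (h : Emb R A B) (h' : Emb R A' B') : Emb R (A ∪ A') (B ∪ B') := by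
  refine Emb.glue (I := Bool) (fun b => cond b A' A) (fun b => cond b B' B) ?_ ?_ ?_ ?_ ?_
  · rintro x (hx | hx)
    · exact Set.mem_iUnion.2 ⟨false, hx⟩
    · exact Set.mem_iUnion.2 ⟨true, hx⟩
  · rintro (_ | _) (_ | _) hij
    · exact absurd hij (lt_irrefl _)
    · exact hA
    · exact absurd hij (by decide)
    · exact absurd hij (lt_irrefl _)
  · rintro (_ | _)
    · exact Set.subset_union_left
    · exact Set.subset_union_right
  · rintro (_ | _) (_ | _) hij
    · exact absurd hij (lt_irrefl _)
    · exact hB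
    · exact absurd hij (by decide)
    · exact absurd hij (lt_irrefl _)
  · rintro (_ | _)
    · exact h
    · exact h'

lemma fin_blk_ind (Qp : Set α → Prop) (h0 : Qp ∅)
    (hadd : ∀ A B, LL A B → Qp A → Qp B → Qp (A ∪ B)) (𝓜 : Set (Set α)) (hfin : 𝓜.Finite)
    (hch : Ch 𝓜) (hp : ∀ M ∈ 𝓜, Qp M) : Qp (⋃₀ 𝓜) := by
  induction hn : 𝓜.ncard generalizing 𝓜 with
  | zero =>
    have : 𝓜 = ∅ := (Set.ncard_eq_zero hfin).1 hn
    rw [this, Set.sUnion_empty]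
    exact h0
  | succ n ih =>
    have hne : 𝓜.Nonempty := by
      rw [Set.nonempty_iff_ne_empty]
      rintro rfl
      simp at hn
    let _ := hch.lo
    have : Finite (El 𝓜) := hfin
    have : Nonempty (El 𝓜) := hne.to_subtype
    obtain ⟨M, hM⟩ := Finite.exists_max (fun x : El 𝓜 => x)
    have e : ⋃₀ 𝓜 = ⋃₀ (𝓜 \ {M.1}) ∪ M.1 := by
      rw [← Set.sUnion_singleton M.1, ← Set.sUnion_union, Set.sUnion_singleton,
        Set.sdiff_union_of_subset (Set.singleton_subset_iff.2 M.2)]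
    rw [e]
    refine hadd _ _ ?_ (ih _ hfin.sdiff (hch.mono Set.sdiff_subset) (fun X hX => hp X hX.1) ?_)
      (hp _ M.2)
    · rintro x ⟨X, hX, hx⟩ y hy
      rcases hM ⟨X, hX.1⟩ with h | h
      · exact absurd (congrArg Subtype.val h) hX.2
      · exact h x hx y hy
    · rw [Set.ncard_sdiff_singleton_of_mem M.2, hn]; rfl

/-- `A` is a finite ordered union of pieces satisfying some `P i` -/
def FinB {ι : Type*} (P : ι → Set α → Prop) (A : Set α) : Prop :=
  ∃ 𝓜 : Set (Set α), 𝓜.Finite ∧ Ch 𝓜 ∧ ⋃₀ 𝓜 = A ∧ ∀ M ∈ 𝓜, ∃ i, P i M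

lemma FinB.ind {ι : Type*} {P : ι → Set α → Prop} {A : Set α} (h : FinB P A) (Qp : Set α → Prop)
    (h0 : Qp ∅) (hadd : ∀ A B, LL A B → Qp A → Qp B → Qp (A ∪ B)) (hp : ∀ i M, P i M → Qp M) :
    Qp A := by
  obtain ⟨𝓜, h1, h2, rfl, h3⟩ := h
  exact fin_blk_ind Qp h0 hadd 𝓜 h1 h2 fun M hM => by
    obtain ⟨i, hi⟩ := h3 M hM
    exact hp i M hi

lemma FinB.empty {ι : Type*} (P : ι → Set α → Prop) : FinB P ∅ :=
  ⟨∅, Set.finite_empty, ⟨by simp, by simp⟩, by simp, by simp⟩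

lemma FinB.dual {ι : Type*} {P : ι → Set α → Prop} {A : Set α} (h : FinB P A) :
    @FinB α (dualLO ‹_›) ι P A := by
  obtain ⟨𝓜, h1, h2, h3, h4⟩ := h
  exact ⟨𝓜, h1, h2.dual, h3, h4⟩

lemma FinB.union {ι : Type*} {P : ι → Set α → Prop} {A B : Set α} (h : FinB P A)
    (h' : FinB P B) (hAB : LL A B) : FinB P (A ∪ B) := by
  obtain ⟨𝓜, h1, h2, rfl, h4⟩ := h
  obtain ⟨𝓝, g1, g2, rfl, g4⟩ := h'
  have key : ∀ X ∈ 𝓜, ∀ Y ∈ 𝓝, LL X Y := fun X hX Y hY =>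
    hAB.mono (Set.subset_sUnion_of_mem hX) (Set.subset_sUnion_of_mem hY)
  refine ⟨𝓜 ∪ 𝓝, h1.union g1, ⟨?_, ?_⟩, Set.sUnion_union _ _, ?_⟩
  · rintro B (hB | hB)
    · exact h2.ne B hB
    · exact g2.ne B hB
  · rintro B (hB | hB) B' (hB' | hB')
    · exact h2.tot _ hB _ hB'
    · exact Or.inr (Or.inl (key _ hB _ hB'))
    · exact Or.inr (Or.inr (key _ hB' _ hB))
    · exact g2.tot _ hB _ hB'
  · rintro M (hM | hM)
    · exact h4 M hM
    · exact g4 M hM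

lemma FinB.single {ι : Type*} {P : ι → Set α → Prop} {A : Set α} (i : ι) (h : P i A) :
    FinB P A := by
  rcases A.eq_empty_or_nonempty with rfl | hne
  · exact FinB.empty P
  · refine ⟨{A}, Set.finite_singleton _, ⟨?_, ?_⟩, by simp, ?_⟩
    · rintro B rfl; exact hne
    · rintro B rfl B' rfl; exact Or.inl rfl
    · rintro B rfl; exact ⟨i, h⟩

lemma FinB.imp {ι ι' : Type*} {P : ι → Set α → Prop} {P' : ι' → Set α → Prop} {A : Set α}
    (h : FinB P A) (hp : ∀ i M, M ⊆ A → P i M → ∃ j, P' j M) : FinB P' A := by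
  obtain ⟨𝓜, h1, h2, rfl, h4⟩ := h
  refine ⟨𝓜, h1, h2, rfl, fun M hM => ?_⟩
  obtain ⟨i, hi⟩ := h4 M hM
  exact hp i M (Set.subset_sUnion_of_mem hM) hi

end basic

end TSS


namespace TSS

open Cardinal

section defs

variable {α : Type} [lo : LinearOrder α] {ι : Type}

/-- upper bound for a sum -/
def UpSum (a : Ordinal.{0}) (P : ι → Set α → Prop) (A : Set α) : Prop :=
  ∃ 𝓒 : Set (Set α), Ch 𝓒 ∧ ⋃₀ 𝓒 = A ∧ (∀ C ∈ 𝓒, FinB P C) ∧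
    (∀ X ⊆ 𝓒, X.Nonempty → ∃ C ∈ X, ∀ C' ∈ X, ¬ LL C' C) ∧
    ∀ C ∈ 𝓒, #{C' // C' ∈ 𝓒 ∧ LL C' C} < a.card

/-- lower bound for a sum -/
def DnSum (a : Ordinal.{0}) (P : ι → Set α → Prop) (B : Set α) : Prop :=
  ∃ 𝓦 : Set (Set α), Ch 𝓦 ∧ 𝓦.Nonempty ∧ (∀ W ∈ 𝓦, W ⊆ B) ∧
    (∀ S ⊆ 𝓦, #S < a.card → ∃ W ∈ 𝓦, ∀ X ∈ S, LL X W) ∧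
    ∀ j, ∀ X ∈ 𝓦, ∃ Y ∈ 𝓦, LL X Y ∧ P j Y

/-- no increasing sequence of length `a` -/
def NoInc (a : Ordinal.{0}) (𝓒 : Set (Set α)) : Prop :=
  ¬ ∃ g : Ordinal.{0} → Set α, (∀ ξ < a, g ξ ∈ 𝓒) ∧ ∀ ξ ζ, ξ < ζ → ζ < a → LL (g ξ) (g ζ)

/-- sigma-scattered chains -/
def SigSc (𝓒 : Set (Set α)) : Prop :=
  ∃ A : ℕ → Set (Set α), (∀ C ∈ 𝓒, ∃ n, C ∈ A n) ∧ ∀ n, ¬ ∃ f : ℚ → Set α,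
    (∀ q, f q ∈ 𝓒 ∧ f q ∈ A n) ∧ ∀ p q, p < q → LL (f p) (f q)

/-- upper bound for a shuffle -/
def UpShuf (a b : Ordinal.{0}) (P : ι → Set α → Prop) (A : Set α) : Prop :=
  ∃ 𝓒 : Set (Set α), Ch 𝓒 ∧ ⋃₀ 𝓒 = A ∧ (∀ C ∈ 𝓒, FinB P C) ∧ SigSc 𝓒 ∧ NoInc a 𝓒 ∧
    @NoInc α (dualLO lo) b 𝓒

/-- members of the family contain increasing sequences of members -/
def IncF (a : Ordinal.{0}) (𝓕 : Set (Set α)) : Prop :=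
  ∀ J ∈ 𝓕, ∀ δ < a, ∃ s : Ordinal.{0} → Set α, ∃ top ∈ 𝓕, top ⊆ J ∧
    (∀ ξ < δ, s ξ ∈ 𝓕 ∧ s ξ ⊆ J ∧ LL (s ξ) top) ∧ ∀ ξ ζ, ξ < ζ → ζ < δ → LL (s ξ) (s ζ)

/-- members of the family contain many copies of pieces -/
def MidF (P : Set α → Prop) (𝓕 : Set (Set α)) : Prop :=
  ∀ J ∈ 𝓕, ∃ J0 ∈ 𝓕, ∃ J1 ∈ 𝓕, ∃ C, J0 ⊆ J ∧ J1 ⊆ J ∧ C ⊆ J ∧ LL J0 C ∧ LL C J1 ∧ LL J0 J1 ∧ P C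

/-- lower bound for a shuffle -/
def DnShuf (a b : Ordinal.{0}) (P : ι → Set α → Prop) (B : Set α) : Prop :=
  ∃ 𝓕 : Set (Set α), (∃ J ∈ 𝓕, J ⊆ B) ∧ IncF a 𝓕 ∧ @IncF α (dualLO lo) b 𝓕 ∧
    ∀ j, MidF (P j) 𝓕

/-- upper bound at nodes -/
def UpN (k : Fin 3) (a b : Ordinal.{0}) (P : ι → Set α → Prop) (A : Set α) : Prop :=
  match k with
  | 0 => UpSum a P A
  | 1 => @UpSum α (dualLO lo) ι a P A
  | 2 => UpShuf a b P A

/-- lower bound at nodes -/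
def DnN (k : Fin 3) (a b : Ordinal.{0}) (P : ι → Set α → Prop) (A : Set α) : Prop :=
  match k with
  | 0 => DnSum a P A
  | 1 => @DnSum α (dualLO lo) ι a P A
  | 2 => DnShuf a b P A

universe u

variable {Q : Type u} (r : Q → Q → Prop) (l : α → Q)

/-- upper bound -/
def Up : Code Q → Set α → Prop
  | .leaf q => fun A => A.Subsingleton ∧ ∀ x ∈ A, r (l x) q
  | .node k a b _ f => fun A => UpN k a b (fun i => Up (f i)) A

/-- lower bound -/
def Dn : Code Q → Set α → Prop
  | .leaf q => fun A => ∃ x ∈ A, r q (l x)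
  | .node k a b _ f => fun A => DnN k a b (fun i => Dn (f i)) A

lemma DnSum.mono {a : Ordinal.{0}} {P : ι → Set α → Prop} {B B' : Set α} (h : DnSum a P B)
    (hB : B ⊆ B') : DnSum a P B' := by
  obtain ⟨W, h1, h0, h2, h3⟩ := h
  exact ⟨W, h1, h0, fun X hX => (h2 X hX).trans hB, h3⟩

lemma DnShuf.mono {a b : Ordinal.{0}} {P : ι → Set α → Prop} {B B' : Set α} (h : DnShuf a b P B)
    (hB : B ⊆ B') : DnShuf a b P B' := by
  obtain ⟨F, ⟨J, hJ, hJB⟩, h3⟩ := h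
  exact ⟨F, ⟨J, hJ, hJB.trans hB⟩, h3⟩

lemma Dn.mono {h : Code Q} {B B' : Set α} (hd : Dn r l h B) (hB : B ⊆ B') : Dn r l h B' := by
  cases h with
  | leaf q =>
    obtain ⟨x, hx, hr⟩ := hd
    exact ⟨x, hB hx, hr⟩
  | node k a b ι f =>
    match k with
    | 0 => exact DnSum.mono hd hB
    | 1 =>
      refine @DnSum.mono α (dualLO lo) ι a (fun i => Dn r l (f i)) B B' ?_ hB
      exact hd
    | 2 => exact DnShuf.mono hd hB

lemma DnSum.imp {ι' : Type} {a a' : Ordinal.{0}} (haa : a ≤ a') {P : ι → Set α → Prop}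
    {P' : ι' → Set α → Prop} {B : Set α} (hP : ∀ i, ∃ j, ∀ M, P' j M → P i M)
    (h : DnSum a' P' B) : DnSum a P B := by
  obtain ⟨W, h1, h0, h2, h3, h4⟩ := h
  refine ⟨W, h1, h0, h2, fun S hS hc => h3 S hS (hc.trans_le (Ordinal.card_le_card haa)), ?_⟩
  intro i X hX
  obtain ⟨j, hj⟩ := hP i
  obtain ⟨Y, hY, hXY, hp⟩ := h4 j X hX
  exact ⟨Y, hY, hXY, hj _ hp⟩

lemma DnShuf.imp {ι' : Type} {a a' b b' : Ordinal.{0}} (haa : a ≤ a') (hbb : b ≤ b')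
    {P : ι → Set α → Prop}
    {P' : ι' → Set α → Prop} {B : Set α} (hP : ∀ i, ∃ j, ∀ M, P' j M → P i M)
    (h : DnShuf a' b' P' B) : DnShuf a b P B := by
  obtain ⟨F, h1, h2, h3, h4⟩ := h
  refine ⟨F, h1, fun J hJ δ hδ => h2 J hJ δ (hδ.trans_le haa),
    fun J hJ δ hδ => h3 J hJ δ (hδ.trans_le hbb), ?_⟩
  intro i J hJ
  obtain ⟨j, hj⟩ := hP i
  obtain ⟨J0, g0, J1, g1, C, k1, k2, k3, k4, k5, k6, k7⟩ := h4 j J hJ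
  exact ⟨J0, g0, J1, g1, C, k1, k2, k3, k4, k5, k6, hj _ k7⟩

variable {r}

lemma Dn.le (ht : Transitive r) {h g : Code Q} (hle : Le r h g) :
    ∀ B : Set α, Dn r l g B → Dn r l h B := by
  induction hle with
  | leaf hpq =>
    rintro B ⟨x, hx, hr⟩
    exact ⟨x, hx, ht hpq hr⟩
  | @into h k a b ι g j hj ih =>
    intro B hB
    match k with
    | 0 =>
      obtain ⟨W, h1, ⟨X, hX⟩, h2, h3, h4⟩ := hB
      obtain ⟨Y, hY, -, hp⟩ := h4 j X hX
      exact (ih _ hp).mono (hB := h2 Y hY)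
    | 1 =>
      obtain ⟨W, h1, ⟨X, hX⟩, h2, h3, h4⟩ := hB
      obtain ⟨Y, hY, -, hp⟩ := h4 j X hX
      exact (ih _ hp).mono (hB := h2 Y hY)
    | 2 =>
      obtain ⟨F, ⟨J, hJ, hJB⟩, h2, h3, h4⟩ := hB
      obtain ⟨J0, g0, J1, g1, C, k1, k2, k3, k4, k5, k6, k7⟩ := h4 j J hJ
      exact (ih _ k7).mono (hB := k3.trans hJB)
  | @node k a b a' b' ι ι' f g ha hb w hw ih =>
    intro B hB
    match k with
    | 0 => exact DnSum.imp ha (fun i => ⟨w i, ih i⟩) hB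
    | 1 => exact @DnSum.imp α (dualLO lo) ι ι' a a' ha (fun i => Dn r l (f i)) (fun i => Dn r l (g i)) B (fun i => ⟨w i, ih i⟩) hB
    | 2 => exact DnShuf.imp ha hb (fun i => ⟨w i, ih i⟩) hB

end defs
end TSS


namespace TSS

open Cardinal

lemma sum_rec {I V : Type*} [LinearOrder I] [WellFoundedLT I] [LinearOrder V]
    (T : I → V → V → Prop) (hb : ∀ i, ∀ h : {j : I // j < i} → V, ∃ v, ∀ j, h j ≤ v)
    (hs : ∀ i v, ∃ v', v ≤ v' ∧ T i v v') :
    ∃ lo hi : I → V, (∀ i, lo i ≤ hi i ∧ T i (lo i) (hi i)) ∧ ∀ j i, j < i → hi j ≤ lo i := by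
  have step : ∀ i, ∀ h : (∀ j, j < i → V × V), ∃ p : V × V, (∀ j hj, (h j hj).2 ≤ p.1) ∧
      p.1 ≤ p.2 ∧ T i p.1 p.2 := by
    intro i h
    obtain ⟨v, hv⟩ := hb i (fun j => (h j.1 j.2).2)
    obtain ⟨v', h1, h2⟩ := hs i v
    exact ⟨(v, v'), fun j hj => hv ⟨j, hj⟩, h1, h2⟩
  choose F hF using step
  let g : I → V × V := (wellFounded_lt (α := I)).fix F
  have hg : ∀ i, g i = F i (fun j _ => g j) := fun i => WellFounded.fix_eq _ F i
  refine ⟨fun i => (g i).1, fun i => (g i).2, fun i => ?_, fun j i hji => ?_⟩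
  · have := (hF i (fun j _ => g j)).2
    rw [← hg] at this
    exact this
  · have := (hF i (fun j _ => g j)).1 j hji
    rw [← hg] at this
    exact this

theorem sum_comp {α β : Type} [LinearOrder α] [LinearOrder β] {ι : Type} {a : Ordinal.{0}}
    {P : ι → Set α → Prop} {P' : ι → Set β → Prop} {A : Set α} {B : Set β} (R : α → β → Prop)
    (hU : UpSum a P A) (hD : DnSum a P' B) (hPP : ∀ i M N, P i M → P' i N → Emb R M N) :
    Emb R A B := by
  obtain ⟨𝓒, hC, rfl, hfin, hwf, hcard⟩ := hU
  obtain ⟨𝓦, hW, ⟨W0, hW0⟩, hWB, hbd, hcof⟩ := hD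
  let _ := hC.lo
  let _ := hW.lo
  have : WellFoundedLT (El 𝓒) := by
    refine ⟨WellFounded.wellFounded_iff_has_min.2 fun X hX => ?_⟩
    obtain ⟨C, ⟨c, hc, rfl⟩, hmin⟩ := hwf ((fun x : El 𝓒 => x.1) '' X) (by rintro _ ⟨x, _, rfl⟩; exact x.2)
      (hX.image _)
    exact ⟨c, hc, fun x hx hlt => hmin x.1 ⟨x, hx, rfl⟩ hlt⟩
  let U : El 𝓦 → El 𝓦 → Set β := fun v v' => ⋃ X ∈ {X : El 𝓦 | v < X ∧ X ≤ v'}, X.1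
  have hUm : ∀ v v' w w', w ≤ v → v' ≤ w' → U v v' ⊆ U w w' := by
    intro v v' w w' h1 h2 x hx
    simp only [U, Set.mem_iUnion] at hx ⊢
    obtain ⟨X, ⟨hX1, hX2⟩, hx⟩ := hx
    exact ⟨X, ⟨lt_of_le_of_lt h1 hX1, le_trans hX2 h2⟩, hx⟩
  have hUL : ∀ v v' w w', v' ≤ w → LL (U v v') (U w w') := by
    intro v v' w w' h x hx y hy
    simp only [U, Set.mem_iUnion] at hx hy
    obtain ⟨X, ⟨hX1, hX2⟩, hx⟩ := hx
    obtain ⟨Y, ⟨hY1, hY2⟩, hy⟩ := hy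
    have : X < Y := lt_of_le_of_lt (le_trans hX2 h) hY1
    exact this x hx y hy
  have key := sum_rec (I := El 𝓒) (V := El 𝓦) (fun C v v' => Emb R C.1 (U v v'))
  refine Exists.elim (key ?_ ?_) (fun lo hlo => Exists.elim hlo fun hi hh => ?_)
  rotate_left 2
  · obtain ⟨h1, h2⟩ := hh
    refine Emb.glue (I := El 𝓒) (fun C => C.1) (fun C => U (lo C) (hi C)) ?_ (fun i j hij => hij) ?_
      (fun i j hij => hUL _ _ _ _ (h2 i j hij)) (fun i => (h1 i).2)
    · rintro x ⟨C, hC, hx⟩; exact Set.mem_iUnion.2 ⟨⟨C, hC⟩, hx⟩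
    · intro C x hx
      simp only [U, Set.mem_iUnion] at hx
      obtain ⟨X, -, hx⟩ := hx
      exact hWB _ X.2 hx
  · intro C h
    have hc : #(Set.range fun j => (h j).1) < a.card := by
      refine lt_of_le_of_lt Cardinal.mk_range_le (lt_of_le_of_lt ?_ (hcard C.1 C.2))
      exact Cardinal.mk_le_of_injective (f := fun j => ⟨j.1.1, j.1.2, j.2⟩) (by
        intro x y hxy
        simp only [Subtype.mk.injEq] at hxy
        exact Subtype.ext (Subtype.ext hxy))
    obtain ⟨W, hW1, hW2⟩ := hbd _ (by rintro _ ⟨x, rfl⟩; exact (h x).2) hc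
    exact ⟨⟨W, hW1⟩, fun j => Or.inr (hW2 _ ⟨j, rfl⟩)⟩
  · intro C
    refine (hfin C.1 C.2).ind (fun M => ∀ v, ∃ v', v ≤ v' ∧ Emb R M (U v v')) ?_ ?_ ?_
    · intro v
      exact ⟨v, le_rfl, Emb.empty _ _⟩
    · intro M N hMN hM hN v
      obtain ⟨v1, h1, e1⟩ := hM v
      obtain ⟨v2, h2, e2⟩ := hN v1
      refine ⟨v2, le_trans h1 h2, (Emb.union hMN (hUL v v1 v1 v2 le_rfl) e1 e2).mono ?_⟩
      exact Set.union_subset (hUm _ _ _ _ le_rfl h2) (hUm _ _ _ _ h1 le_rfl)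
    · intro i M hM v
      obtain ⟨Y, hY, hvY, hp⟩ := hcof i v.1 v.2
      refine ⟨⟨Y, hY⟩, Or.inr hvY, (hPP i M Y hM hp).mono ?_⟩
      intro x hx
      simp only [U, Set.mem_iUnion]
      exact ⟨⟨Y, hY⟩, ⟨hvY, le_rfl⟩, hx⟩

end TSS


namespace TSS

/-- closure conditions for the condensation argument -/
structure Cond {T : Type*} [LinearOrder T] (𝒢 : Set T → Prop) : Prop where
  mono : ∀ A B, A ⊆ B → 𝒢 B → 𝒢 A
  single : ∀ x, 𝒢 {x}
  add : ∀ A B, LL A B → 𝒢 A → 𝒢 B → 𝒢 (A ∪ B)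
  plus : ∀ K, (∀ x ∈ K, 𝒢 (K ∩ {y | y ≤ x})) → 𝒢 K
  minus : ∀ K, (∀ x ∈ K, 𝒢 (K ∩ {y | x ≤ y})) → 𝒢 K

/-- the convex hull of two points -/
def btw {T : Type*} [LinearOrder T] (x y : T) : Set T := {z | (x ≤ z ∧ z ≤ y) ∨ (y ≤ z ∧ z ≤ x)}

lemma btw_comm {T : Type*} [LinearOrder T] (x y : T) : btw x y = btw y x := by
  ext z; simp only [btw, Set.mem_setOf_eq]; tauto

namespace Cond

variable {T : Type*} [LinearOrder T] {𝒢 : Set T → Prop}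

lemma rfl' (h : Cond 𝒢) (x : T) : 𝒢 (btw x x) := by
  refine h.mono _ {x} ?_ (h.single x)
  rintro z (⟨h1, h2⟩ | ⟨h1, h2⟩) <;> exact le_antisymm h2 h1

lemma trans_le (h : Cond 𝒢) {x y z : T} (hxy : x ≤ y) (h1 : 𝒢 (btw x y)) (h2 : 𝒢 (btw y z)) :
    𝒢 (btw x z) := by
  have : 𝒢 (btw x y ∪ (btw y z ∩ {t | y < t})) := by
    refine h.add _ _ ?_ h1 (h.mono _ _ Set.inter_subset_left h2)
    rintro s hs t ⟨-, ht⟩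
    rcases hs with hs | hs
    · exact lt_of_le_of_lt hs.2 ht
    · exact lt_of_le_of_lt (hs.2.trans hxy) ht
  by_cases hyz : x ≤ z
  · refine h.mono _ _ ?_ this
    intro t ht
    have ht' : x ≤ t ∧ t ≤ z := by
      rcases ht with ht | ht
      · exact ht
      · exact ⟨hyz.trans ht.1, ht.2.trans hyz⟩
    rcases le_or_gt t y with hty | hty
    · exact Or.inl (Or.inl ⟨ht'.1, hty⟩)
    · exact Or.inr ⟨Or.inl ⟨hty.le, ht'.2⟩, hty⟩
  · refine h.mono _ _ ?_ h2
    push Not at hyz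
    intro t ht
    rcases ht with ht | ht
    · exact Or.inr ⟨hyz.le.trans ht.1, (ht.2.trans hyz.le).trans hxy⟩
    · exact Or.inr ⟨ht.1, ht.2.trans hxy⟩

lemma trans (h : Cond 𝒢) {x y z : T} (h1 : 𝒢 (btw x y)) (h2 : 𝒢 (btw y z)) : 𝒢 (btw x z) := by
  rcases le_total x y with hxy | hxy
  · exact h.trans_le hxy h1 h2
  · rcases le_total z y with hzy | hzy
    · rw [btw_comm] at h1 h2 ⊢
      exact h.trans_le hzy h2 h1
    · rcases le_total x z with hxz | hxz
      · refine h.mono _ _ ?_ h2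
        rintro t (ht | ht)
        · exact Or.inl ⟨hxy.trans ht.1, ht.2⟩
        · exact Or.inl ⟨hzy.trans ht.1, ht.2.trans hxz⟩
      · refine h.mono _ _ ?_ h1
        rintro t (ht | ht)
        · exact Or.inr ⟨hxy.trans ht.1, ht.2.trans hxz⟩
        · exact Or.inr ⟨hzy.trans ht.1, ht.2⟩

lemma pairwise (h : Cond 𝒢) (K : Set T) (hK : ∀ x ∈ K, ∀ y ∈ K, 𝒢 (btw x y)) : 𝒢 K := by
  rcases K.eq_empty_or_nonempty with rfl | ⟨x0, hx0⟩
  · exact h.plus _ (by simp)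
  have e : K = (K ∩ {y | y < x0}) ∪ (K ∩ {y | x0 ≤ y}) := by
    ext y
    rcases lt_or_ge y x0 with hy | hy <;> simp [hy]
  rw [e]
  refine h.add _ _ ?_ ?_ ?_
  · rintro x ⟨-, hx⟩ y ⟨-, hy⟩
    exact lt_of_lt_of_le hx hy
  · refine h.minus _ ?_
    rintro x ⟨hx, hx'⟩
    refine h.mono _ _ ?_ (hK x hx x0 hx0)
    rintro y ⟨⟨-, hy⟩, hy'⟩
    exact Or.inl ⟨hy', le_of_lt hy⟩
  · refine h.plus _ ?_
    rintro x ⟨hx, hx'⟩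
    refine h.mono _ _ ?_ (hK x0 hx0 x hx)
    rintro y ⟨⟨-, hy⟩, hy'⟩
    exact Or.inl ⟨hy, hy'⟩

lemma dense (h : Cond 𝒢) {x y : T} (hxy : x < y) (hn : ¬ 𝒢 (btw x y)) :
    ∃ z, x < z ∧ z < y ∧ ¬ 𝒢 (btw x z) ∧ ¬ 𝒢 (btw z y) := by
  by_contra hcon
  push Not at hcon
  apply hn
  let K1 : Set T := {z | x ≤ z ∧ z ≤ y ∧ 𝒢 (btw x z)}
  let K2 : Set T := {z | x ≤ z ∧ z ≤ y ∧ 𝒢 (btw z y)}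
  have h1 : 𝒢 K1 := h.pairwise _ (by
    rintro a ⟨-, -, ha⟩ b ⟨-, -, hb⟩
    rw [btw_comm] at ha
    exact h.trans ha hb)
  have h2 : 𝒢 K2 := h.pairwise _ (by
    rintro a ⟨-, -, ha⟩ b ⟨-, -, hb⟩
    rw [btw_comm] at hb
    exact h.trans ha hb)
  refine h.mono _ (K1 ∪ K2) ?_ (h.add K1 K2 ?_ h1 h2)
  · rintro z (hz | hz)
    · rcases eq_or_lt_of_le hz.1 with rfl | hxz
      · exact Or.inl ⟨le_rfl, hz.2, h.rfl' _⟩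
      · rcases eq_or_lt_of_le hz.2 with rfl | hzy
        · exact Or.inr ⟨hz.1, le_rfl, h.rfl' _⟩
        · by_cases hh : 𝒢 (btw x z)
          · exact Or.inl ⟨hz.1, hz.2, hh⟩
          · exact Or.inr ⟨hz.1, hz.2, hcon z hxz hzy hh⟩
    · exact absurd (hz.1.trans hz.2) (not_le.2 hxy)
  · rintro a ⟨ha1, ha2, ha⟩ b ⟨hb1, hb2, hb⟩
    by_contra hab
    push Not at hab
    apply hn
    refine h.trans (h.mono _ _ ?_ ha) hb
    rintro t (ht | ht)
    · exact Or.inl ⟨ht.1, ht.2.trans hab⟩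
    · exact Or.inl ⟨hb1.trans ht.1, (ht.2.trans hb1).trans hab⟩

/-- the equivalence relation -/
def setoid (h : Cond 𝒢) : Setoid T where
  r x y := 𝒢 (btw x y)
  iseqv := ⟨h.rfl', fun hxy => by rwa [btw_comm], h.trans⟩

theorem scattered (h : Cond 𝒢) (hT : ¬ ∃ f : ℚ → T, StrictMono f) : 𝒢 Set.univ := by
  refine h.pairwise _ fun x _ y _ => ?_
  by_contra hxy
  apply hT
  let rep : T → T := fun x => (Quotient.mk h.setoid x).out
  have hrep : ∀ x, 𝒢 (btw (rep x) x) := fun x => Quotient.exact (s := h.setoid) (Quotient.out_eq _)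
  have hrep' : ∀ x y, 𝒢 (btw x y) → rep x = rep y := fun x y hh => by
    have : Quotient.mk h.setoid x = Quotient.mk h.setoid y := Quotient.sound hh
    simp only [rep, this]
  let D : Set T := Set.range rep
  have hlt : ∀ a b, a < b → ¬ 𝒢 (btw a b) → a < rep b ∧ rep a < b := by
    intro a b hab hn
    constructor
    · by_contra hcc
      push Not at hcc
      apply hn
      refine h.mono _ _ ?_ (hrep b)
      rintro t (ht | ht)
      · exact Or.inl ⟨hcc.trans ht.1, ht.2⟩
      · exact absurd (ht.1.trans ht.2) (not_le.2 hab)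
    · by_contra hcc
      push Not at hcc
      apply hn
      refine h.mono _ _ ?_ (hrep a)
      rintro t (ht | ht)
      · exact Or.inr ⟨ht.1, ht.2.trans hcc⟩
      · exact absurd (ht.1.trans ht.2) (not_le.2 hab)
  have hrr : ∀ a, rep (rep a) = rep a := fun a => hrep' _ _ (hrep a)
  have hne : ∀ a b : D, a.1 < b.1 → ¬ 𝒢 (btw a.1 b.1) := by
    rintro ⟨_, a, rfl⟩ ⟨_, b, rfl⟩ hab hcc
    have := hrep' _ _ hcc
    rw [hrr, hrr] at this
    exact absurd this hab.ne
  have : DenselyOrdered D := by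
    refine ⟨fun a b hab => ?_⟩
    obtain ⟨z, h1, h2, h3, h4⟩ := h.dense hab (hne a b hab)
    exact ⟨⟨rep z, z, rfl⟩, (hlt _ _ h1 h3).1, (hlt _ _ h2 h4).2⟩
  have : Nontrivial D := by
    refine ⟨⟨rep x, x, rfl⟩, ⟨rep y, y, rfl⟩, fun e => hxy ?_⟩
    have e' : rep x = rep y := congrArg Subtype.val e
    have h1 := hrep x
    rw [btw_comm, e'] at h1
    exact h.trans h1 (hrep y)
  obtain ⟨f⟩ := Order.embedding_from_countable_to_dense ℚ D
  exact ⟨fun q => (f q).1, fun p q hpq => f.strictMono hpq⟩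

end Cond
end TSS


namespace TSS

open Cardinal

lemma exists_cof {T : Type} [LinearOrder T] (K : Set T) : ∃ κ : Cardinal.{0}, ∃ S ⊆ K,
    (∀ x ∈ K, ∃ s ∈ S, x ≤ s) ∧ (∀ X ⊆ S, X.Nonempty → ∃ s ∈ X, ∀ t ∈ X, s ≤ t) ∧
    (∀ s ∈ S, #{t // t ∈ S ∧ t < s} < κ) ∧ ∀ X ⊆ K, #X < κ → ∃ y ∈ K, ∀ x ∈ X, x < y := by
  obtain ⟨s, hs, hc⟩ := Order.exists_cof_eq (α := K)
  obtain ⟨w, hw, hwo⟩ := Cardinal.ord_eq s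
  let S' : Set s := {x | ∀ y, w y x → y < x}
  refine ⟨Order.cof K, {x | ∃ y ∈ S', x = y.1.1}, ?_, ?_, ?_, ?_, ?_⟩
  · rintro _ ⟨y, _, rfl⟩
    exact y.1.2
  · intro x hx
    obtain ⟨y, hy, hxy⟩ := hs ⟨x, hx⟩
    -- least upper element
    have hwf : WellFounded w := hw.wf
    let U : Set s := {z | x ≤ z.1.1}
    have hU : U.Nonempty := ⟨⟨y, hy⟩, hxy⟩
    refine ⟨(hwf.min U hU).1.1, ⟨_, ?_, rfl⟩, hwf.min_mem U hU⟩
    intro z hz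
    by_contra hcon
    push Not at hcon
    have : x ≤ z.1.1 := le_trans (hwf.min_mem U hU) hcon
    exact hwf.not_lt_min U (x := z) this hz
  · intro X hX hne
    have hwf : WellFounded w := hw.wf
    let U : Set s := {z | z ∈ S' ∧ z.1.1 ∈ X}
    have hU : U.Nonempty := by
      obtain ⟨x, hx⟩ := hne
      obtain ⟨y, hy, rfl⟩ := hX hx
      exact ⟨y, hy, hx⟩
    refine ⟨(hwf.min U hU).1.1, (hwf.min_mem U hU).2, ?_⟩
    intro t ht
    obtain ⟨y, hy, rfl⟩ := hX ht
    rcases trichotomous_of w y (hwf.min U hU) with h | h | h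
    · exact absurd h (hwf.not_lt_min U (x := y) ⟨hy, ht⟩)
    · rw [← h]
    · exact (hy _ h).le
  · rintro _ ⟨y, hy, rfl⟩
    have h1 : #{z // w z y} < Order.cof K := by
      have := Cardinal.card_typein_lt (r := w) y hwo
      rwa [← hc]
    refine lt_of_le_of_lt ?_ h1
    refine Cardinal.mk_le_of_injective (f := fun t => ⟨t.2.1.choose, ?_⟩) ?_
    · obtain ⟨h2, h3⟩ := t.2.1.choose_spec
      rcases trichotomous_of w t.2.1.choose y with h | h | h
      · exact h
      · have := t.2.2
        rw [h3, h] at this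
        exact absurd this (lt_irrefl _)
      · have := t.2.2
        rw [h3] at this
        exact absurd (h2 _ h) (not_lt.2 this.le)
    · intro t t' htt
      have e : t.2.1.choose = t'.2.1.choose := congrArg Subtype.val htt
      apply Subtype.ext
      rw [t.2.1.choose_spec.2, t'.2.1.choose_spec.2, e]
  · intro X hX hlt
    let X' : Set K := {x | x.1 ∈ X}
    have h1 : ¬ IsCofinal X' := fun h => by
      have := Order.cof_le h
      have h2 : #X' ≤ #X := Cardinal.mk_le_of_injective (f := fun x => ⟨x.1.1, x.2⟩) (by
        intro a b hab
        apply Subtype.ext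
        apply Subtype.ext
        have := congrArg Subtype.val hab
        exact this)
      exact absurd hlt (not_lt.2 (this.trans h2))
    rw [not_isCofinal_iff] at h1
    obtain ⟨y, hy⟩ := h1
    refine ⟨y.1, y.2, fun x hx => ?_⟩
    exact hy (y := ⟨x, hX hx⟩) hx

end TSS


namespace TSS

section shuf

variable {I β : Type} [loI : LinearOrder I] [loB : LinearOrder β]

/-- separated by a point of `K` -/
def Sep (K : Set I) (d d' : I) : Prop := ∃ t ∈ K, t ∈ btw d d'

structure Inv (P : I → Set β → Prop) (𝓕 : Set (Set β)) (K : Set I) (z : I → Set β) : Prop where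
  p : ∀ d ∈ K, P d (z d)
  f : ∀ d, d ∉ K → z d ∈ 𝓕
  l : ∀ d d', d < d' → Sep K d d' → LL (z d) (z d')
  e : ∀ d d', ¬ Sep K d d' → z d = z d'

def EE (P : I → Set β → Prop) (𝓕 : Set (Set β)) (K : Set I) : Prop :=
  ∀ J ∈ 𝓕, ∃ z : I → Set β, Inv P 𝓕 K z ∧ ∀ d, z d ⊆ J

lemma btw_dual (x y : I) : @btw I (dualLO loI) x y = btw x y := by
  ext z
  constructor
  · rintro (⟨h1, h2⟩ | ⟨h1, h2⟩)
    · exact Or.inr ⟨h2, h1⟩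
    · exact Or.inl ⟨h2, h1⟩
  · rintro (⟨h1, h2⟩ | ⟨h1, h2⟩)
    · exact Or.inr ⟨h2, h1⟩
    · exact Or.inl ⟨h2, h1⟩

lemma Sep.dual {K : Set I} {d d' : I} : @Sep I (dualLO loI) K d d' ↔ Sep K d d' := by
  unfold Sep
  rw [btw_dual]

lemma Sep.symm {K : Set I} {d d' : I} (h : Sep K d d') : Sep K d' d := by
  unfold Sep at h ⊢
  rwa [btw_comm]

lemma Inv.dual {P : I → Set β → Prop} {𝓕 : Set (Set β)} {K : Set I} {z : I → Set β} :
    @Inv I β (dualLO loI) (dualLO loB) P 𝓕 K z ↔ Inv P 𝓕 K z := by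
  constructor
  · intro h
    refine ⟨@Inv.p I β (dualLO loI) (dualLO loB) P 𝓕 K z h, @Inv.f I β (dualLO loI) (dualLO loB) P 𝓕 K z h,
      fun d d' hd hs => ?_, fun d d' hd => @Inv.e I β (dualLO loI) (dualLO loB) P 𝓕 K z h d d'
        (fun h' => hd (Sep.dual.1 h'))⟩
    exact LL.dual.1 (@Inv.l I β (dualLO loI) (dualLO loB) P 𝓕 K z h d' d hd (Sep.dual.2 hs.symm))
  · intro h
    refine @Inv.mk I β (dualLO loI) (dualLO loB) P 𝓕 K z h.p h.f (fun d d' hd hs => ?_)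
      fun d d' hd => h.e d d' (fun h' => hd (Sep.dual.2 h'))
    exact LL.dual.2 (h.l d' d hd (Sep.dual.1 hs).symm)

lemma EE.dual {P : I → Set β → Prop} {𝓕 : Set (Set β)} {K : Set I} :
    @EE I β (dualLO loI) (dualLO loB) P 𝓕 K ↔ EE P 𝓕 K := by
  unfold EE
  simp only [Inv.dual]

lemma EE.glue {P : I → Set β → Prop} {𝓕 : Set (Set β)} {K : Set I} {V : Type} [LinearOrder V]
    (p : I → V) (hp : Monotone p) (hs : ∀ d d', p d < p d' → Sep K d d')
    (he : ∀ v, EE P 𝓕 {t | t ∈ K ∧ p t = v})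
    (hJ : ∀ J ∈ 𝓕, ∃ s : V → Set β, (∀ v, s v ∈ 𝓕 ∧ s v ⊆ J) ∧ ∀ v w, v < w → LL (s v) (s w)) :
    EE P 𝓕 K := by
  intro J hJF
  obtain ⟨s, hs1, hs2⟩ := hJ J hJF
  have := fun v => he v (s v) (hs1 v).1
  choose z hz1 hz2 using this
  refine ⟨fun d => z (p d) d, ⟨?_, ?_, ?_, ?_⟩, fun d => (hz2 _ _).trans (hs1 _).2⟩
  · intro d hd
    exact (hz1 (p d)).p d ⟨hd, rfl⟩
  · intro d hd
    exact (hz1 (p d)).f d (fun h => hd h.1)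
  · rintro d d' hd ⟨t, ht, hb⟩
    rcases (hp hd.le).lt_or_eq with h | h
    · exact (hs2 _ _ h).mono (hz2 _ _) (hz2 _ _)
    · show LL (z (p d) d) (z (p d') d')
      rw [← h]
      refine (hz1 (p d)).l d d' hd ⟨t, ⟨ht, ?_⟩, hb⟩
      rcases hb with hb | hb
      · exact le_antisymm (h ▸ hp hb.2) (hp hb.1)
      · exact absurd (hb.1.trans hb.2) (not_le.2 hd)
  · intro d d' hd
    have h1 : p d = p d' := by
      rcases lt_trichotomy (p d) (p d') with h | h | h
      · exact absurd (hs _ _ h) hd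
      · exact h
      · exact absurd (hs _ _ h).symm hd
    show z (p d) d = z (p d') d'
    rw [← h1]
    refine (hz1 (p d)).e d d' ?_
    rintro ⟨t, ht, hb⟩
    exact hd ⟨t, ht.1, hb⟩

lemma MidF.dual {P : Set β → Prop} {𝓕 : Set (Set β)} (h : MidF P 𝓕) :
    @MidF β (dualLO loB) P 𝓕 := by
  intro J hJ
  obtain ⟨J0, h0, J1, h1, C, a, b, c, d, e, f, g⟩ := h J hJ
  exact ⟨J1, h1, J0, h0, C, b, a, c, LL.dual.2 e, LL.dual.2 d, LL.dual.2 f, g⟩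

/-- no increasing sequences of length `a` -/
def NoI (I : Type) [LinearOrder I] (a : Ordinal.{0}) : Prop :=
  ¬ ∃ g : Ordinal.{0} → I, ∀ ξ ζ, ξ < ζ → ζ < a → g ξ < g ζ

lemma EE.empty {P : I → Set β → Prop} {𝓕 : Set (Set β)} : EE P 𝓕 ∅ := by
  intro J hJ
  refine ⟨fun _ => J, ⟨fun d h => h.elim, fun _ _ => hJ, ?_, fun _ _ _ => rfl⟩, fun _ => subset_rfl⟩
  rintro d d' _ ⟨t, h, _⟩
  exact h.elim

open Classical in
lemma EE.single {P : I → Set β → Prop} {𝓕 : Set (Set β)} (x : I) (hm : MidF (P x) 𝓕) :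
    EE P 𝓕 {x} := by
  intro J hJ
  obtain ⟨J0, h0, J1, h1, C, a, b, c, d, e, f, g⟩ := hm J hJ
  refine ⟨fun y => if y < x then J0 else if x < y then J1 else C, ⟨?_, ?_, ?_, ?_⟩, ?_⟩
  · rintro y rfl
    simpa using g
  · intro y hy
    rcases lt_or_gt_of_ne hy with h | h
    · simpa [h] using h0
    · simpa [h, h.not_gt] using h1
  · rintro y y' hyy ⟨t, ht, hb⟩
    rw [show t = x from ht] at hb
    have hb' : y ≤ x ∧ x ≤ y' := by
      rcases hb with hb | hb
      · exact hb
      · exact absurd (hb.1.trans hb.2) (not_le.2 hyy)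
    rcases hb'.1.lt_or_eq with h | rfl
    · rcases hb'.2.lt_or_eq with h' | rfl
      · simpa [h, h', h'.not_gt] using f
      · simpa [h] using d
    · simpa [hyy, hyy.not_gt] using e
  · intro y y' hs
    have key : (y < x ↔ y' < x) ∧ (x < y ↔ x < y') := by
      have : x ∉ btw y y' := fun h => hs ⟨x, rfl, h⟩
      simp only [btw, Set.mem_setOf_eq, not_or, not_and, not_le] at this
      constructor
      · constructor
        · intro h; exact this.1 h.le
        · intro h; exact this.2 h.le
      · constructor
        · intro h
          by_contra hc
          exact absurd (this.2 (not_lt.1 hc)) (not_lt.2 h.le)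
        · intro h
          by_contra hc
          exact absurd (this.1 (not_lt.1 hc)) (not_lt.2 h.le)
    simp only [key.1, key.2]
  · intro y
    dsimp only
    split_ifs
    · exact a
    · exact b
    · exact c

open Classical in
lemma EE.add {P : I → Set β → Prop} {𝓕 : Set (Set β)} (hm : ∀ x, MidF (P x) 𝓕) {A B : Set I}
    (hAB : LL A B) (hA : EE P 𝓕 A) (hB : EE P 𝓕 B) : EE P 𝓕 (A ∪ B) := by
  rcases isEmpty_or_nonempty I with hI | ⟨⟨x⟩⟩
  · rw [Set.eq_empty_of_isEmpty (A ∪ B)]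
    exact EE.empty
  let p : I → Bool := fun d => decide (¬ ∃ t ∈ A, d ≤ t)
  have hpA : ∀ d, p d = false ↔ ∃ t ∈ A, d ≤ t := fun d => by simp [p]
  have hpB : ∀ d, p d = true ↔ ¬ ∃ t ∈ A, d ≤ t := fun d => by simp [p]
  refine EE.glue p ?_ ?_ ?_ ?_
  · intro d d' hd
    cases h : p d with
    | false => exact Bool.false_le _
    | true =>
      have : p d' = true := by
        rw [hpB] at h ⊢
        rintro ⟨t, ht, h'⟩
        exact h ⟨t, ht, hd.trans h'⟩
      rw [this]
  · intro d d' hd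
    have h1 : p d = false ∧ p d' = true := by
      revert hd
      cases p d <;> cases p d' <;> decide
    obtain ⟨t, ht, hdt⟩ := (hpA d).1 h1.1
    have h2 := (hpB d').1 h1.2
    refine ⟨t, Or.inl ht, Or.inl ⟨hdt, ?_⟩⟩
    by_contra hc
    exact h2 ⟨t, ht, (not_le.1 hc).le⟩
  · rintro (_ | _)
    · have : {t | t ∈ A ∪ B ∧ p t = false} = A := by
        ext t
        simp only [Set.mem_setOf_eq, hpA]
        constructor
        · rintro ⟨h | h, u, hu, htu⟩
          · exact h
          · exact absurd (hAB u hu t h) (not_lt.2 htu)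
        · intro h
          exact ⟨Or.inl h, t, h, le_rfl⟩
      rw [this]
      exact hA
    · have : {t | t ∈ A ∪ B ∧ p t = true} = B := by
        ext t
        simp only [Set.mem_setOf_eq, hpB]
        constructor
        · rintro ⟨h | h, hn⟩
          · exact absurd ⟨t, h, le_rfl⟩ hn
          · exact h
        · intro h
          refine ⟨Or.inr h, ?_⟩
          rintro ⟨u, hu, htu⟩
          exact absurd (hAB u hu t h) (not_lt.2 htu)
      rw [this]
      exact hB
  · intro J hJ
    obtain ⟨J0, h0, J1, h1, C, a, b, c, d, e, f, g⟩ := hm x J hJ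
    refine ⟨fun v => cond v J1 J0, ?_, ?_⟩
    · rintro (_ | _)
      · exact ⟨h0, a⟩
      · exact ⟨h1, b⟩
    · rintro (_ | _) (_ | _) h
      · exact absurd h (lt_irrefl _)
      · exact f
      · exact absurd h (by decide)
      · exact absurd h (lt_irrefl _)

end shuf
end TSS


namespace TSS

section shuf

variable {I β : Type} [loI : LinearOrder I] [loB : LinearOrder β]

lemma EE.plus {P : I → Set β → Prop} {𝓕 : Set (Set β)} {a : Ordinal.{0}} (hI : NoI I a)
    (hinc : IncF a 𝓕) {K : Set I} (h : ∀ x ∈ K, ∀ K' ⊆ K ∩ {y | y ≤ x}, EE P 𝓕 K') :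
    EE P 𝓕 K := by
  obtain ⟨_, S, hSK, hcof, hwf, -, -⟩ := exists_cof K
  rcases S.eq_empty_or_nonempty with rfl | ⟨x0, hx0⟩
  · have : K = ∅ := by
      rw [Set.eq_empty_iff_forall_notMem]
      intro x hx
      obtain ⟨s, hs, -⟩ := hcof x hx
      exact hs
    rw [this]
    exact EE.empty
  have : WellFoundedLT S := by
    refine ⟨WellFounded.wellFounded_iff_has_min.2 fun X hX => ?_⟩
    obtain ⟨s, ⟨s', hs', rfl⟩, hmin⟩ := hwf (Subtype.val '' X) (by rintro _ ⟨x, _, rfl⟩; exact x.2) (hX.image _)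
    exact ⟨s', hs', fun x hx => not_lt.2 (hmin x.1 ⟨x, hx, rfl⟩)⟩
  have hδ : Ordinal.type (α := S) (· < ·) < a := by
    by_contra hc
    push Not at hc
    classical
    refine hI ⟨fun ξ => if hξ : ξ < Ordinal.type (α := S) (· < ·) then
      (Ordinal.enum (α := S) (· < ·) ⟨ξ, hξ⟩).1 else x0, fun ξ ζ h1 h2 => ?_⟩
    have h3 := h2.trans_le hc
    dsimp only
    rw [dif_pos h3, dif_pos (h1.trans h3)]
    exact (Ordinal.enum_lt_enum (r := ((· < ·) : S → S → Prop))).2 h1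
  have hp : ∀ d : I, ∃ v : WithTop S, (∀ s : S, v = s → d ≤ s.1) ∧ ∀ s : S, d ≤ s.1 → v ≤ s := by
    intro d
    by_cases hd : ∃ s ∈ S, d ≤ s
    · obtain ⟨s, hs, hmin⟩ := hwf {s | s ∈ S ∧ d ≤ s} (fun s hs => hs.1) hd
      refine ⟨((⟨s, hs.1⟩ : S) : WithTop S), ?_, ?_⟩
      · intro t ht
        rw [WithTop.coe_inj] at ht
        rw [← ht]
        exact hs.2
      · intro t ht
        rw [WithTop.coe_le_coe]
        exact hmin t.1 ⟨t.2, ht⟩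
    · exact ⟨⊤, fun s hs => by simp at hs, fun s hs => absurd ⟨s.1, s.2, hs⟩ hd⟩
  choose p hp1 hp2 using hp
  refine EE.glue p ?_ ?_ ?_ ?_
  · intro d d' hd
    cases hv : p d' with
    | top => exact le_top
    | coe s => exact hp2 d s (hd.trans (hp1 d' s hv))
  · intro d d' hd
    cases hv : p d with
    | top => rw [hv] at hd; exact absurd hd not_top_lt
    | coe s =>
      refine ⟨s.1, hSK s.2, Or.inl ⟨hp1 d s hv, ?_⟩⟩
      by_contra hc
      have := hp2 d' s (not_le.1 hc).le
      rw [← hv] at this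
      exact absurd hd (not_lt.2 this)
  · intro v
    cases v with
    | top =>
      have : {t | t ∈ K ∧ p t = ⊤} = ∅ := by
        rw [Set.eq_empty_iff_forall_notMem]
        rintro t ⟨ht, hpt⟩
        obtain ⟨s, hs, hts⟩ := hcof t ht
        have := hp2 t ⟨s, hs⟩ hts
        rw [hpt] at this
        simp at this
      rw [this]
      exact EE.empty
    | coe s =>
      refine h s.1 (hSK s.2) _ ?_
      rintro t ⟨ht, hpt⟩
      exact ⟨ht, hp1 t s hpt⟩
  · intro J hJ
    obtain ⟨s, top, ht, htJ, h1, h2⟩ := hinc J hJ _ hδ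
    have hlt : ∀ x : S, Ordinal.typein ((· < ·) : S → S → Prop) x < Ordinal.type (α := S) (· < ·) :=
      fun x => Ordinal.typein_lt_type _ x
    refine ⟨fun v => WithTop.recTopCoe top (fun x : S => s (Ordinal.typein ((· < ·) : S → S → Prop) x)) v, ?_, ?_⟩
    · intro v
      cases v with
      | top => exact ⟨ht, htJ⟩
      | coe x => exact ⟨(h1 _ (hlt x)).1, (h1 _ (hlt x)).2.1⟩
    · intro v w hvw
      cases v with
      | top => exact absurd hvw not_top_lt
      | coe x =>
        cases w with
        | top => exact (h1 _ (hlt x)).2.2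
        | coe y =>
          refine h2 _ _ ?_ (hlt y)
          rw [Ordinal.typein_lt_typein]
          exact WithTop.coe_lt_coe.1 hvw

lemma cond_EE {P : I → Set β → Prop} {𝓕 : Set (Set β)} {a b : Ordinal.{0}} (hI : NoI I a)
    (hI' : @NoI I (dualLO loI) b) (hinc : IncF a 𝓕) (hinc' : @IncF β (dualLO loB) b 𝓕)
    (hm : ∀ x, MidF (P x) 𝓕) : Cond (fun K : Set I => ∀ K' ⊆ K, EE P 𝓕 K') where
  mono A B hAB hB K' hK' := hB K' (hK'.trans hAB)
  single x K' hK' := by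
    rcases Set.subset_singleton_iff_eq.1 hK' with rfl | rfl
    · exact EE.empty
    · exact EE.single x (hm x)
  add A B hAB hA hB K' hK' := by
    have : K' = (K' ∩ A) ∪ (K' ∩ B) := by
      rw [← Set.inter_union_distrib_left]
      exact (Set.inter_eq_left.2 hK').symm
    rw [this]
    exact EE.add hm (hAB.mono Set.inter_subset_right Set.inter_subset_right)
      (hA _ Set.inter_subset_right) (hB _ Set.inter_subset_right)
  plus K hK K' hK' := by
    refine EE.plus hI hinc fun x hx K'' hK'' => hK x (hK' hx) K'' ?_
    exact hK''.trans (Set.inter_subset_inter_left _ hK')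
  minus K hK K' hK' := by
    refine EE.dual.1 (@EE.plus I β (dualLO loI) (dualLO loB) P 𝓕 b hI' hinc' K' ?_)
    intro x hx K'' hK''
    refine EE.dual.2 (hK x (hK' hx) K'' ?_)
    intro y hy
    exact ⟨hK' (hK'' hy).1, (hK'' hy).2⟩

lemma Cond.sub {𝒢 : Set I → Prop} (h : Cond 𝒢) (A : Set I) :
    Cond (fun X : Set A => 𝒢 (Subtype.val '' X)) where
  mono X Y hXY hY := h.mono _ _ (Set.image_mono hXY) hY
  single x := by simpa using h.single x.1
  add X Y hXY hX hY := by
    rw [Set.image_union]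
    refine h.add _ _ ?_ hX hY
    rintro _ ⟨x, hx, rfl⟩ _ ⟨y, hy, rfl⟩
    exact hXY x hx y hy
  plus K hK := by
    refine h.plus _ ?_
    rintro _ ⟨x, hx, rfl⟩
    refine h.mono _ _ ?_ (hK x hx)
    rintro _ ⟨⟨y, hy, rfl⟩, hyx⟩
    exact ⟨y, ⟨hy, hyx⟩, rfl⟩
  minus K hK := by
    refine h.minus _ ?_
    rintro _ ⟨x, hx, rfl⟩
    refine h.mono _ _ ?_ (hK x hx)
    rintro _ ⟨⟨y, hy, rfl⟩, hyx⟩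
    exact ⟨y, ⟨hy, hyx⟩, rfl⟩

lemma Cond.scattered_sub {𝒢 : Set I → Prop} (h : Cond 𝒢) (A : Set I)
    (hA : ¬ ∃ f : ℚ → A, StrictMono f) : 𝒢 A := by
  have := (h.sub A).scattered hA
  simpa using this

lemma Sep.of_not {T : Set I} {d d' t : I} (h : ¬ Sep T d d') (h' : Sep T d' t) : Sep T d t := by
  obtain ⟨u, hu, hb⟩ := h'
  refine ⟨u, hu, ?_⟩
  have h2 : u ∉ btw d d' := fun hh => h ⟨u, hu, hh⟩
  simp only [btw, Set.mem_ofPred_eq, not_or, not_and, not_le] at h2 hb ⊢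
  rcases le_total d u with h3 | h3 <;> rcases le_total u t with h4 | h4
  · exact Or.inl ⟨h3, h4⟩
  · rcases hb with hb | hb
    · exact Or.inl ⟨h3, hb.2⟩
    · exact absurd hb.2 (not_le.2 (h2.1 h3))
  · rcases hb with hb | hb
    · exact absurd h3 (not_le.2 (h2.2 hb.1))
    · exact Or.inr ⟨hb.1, h3⟩
  · exact Or.inr ⟨h4, h3⟩

open Classical in
lemma Inv.step {P : I → Set β → Prop} {𝓕 : Set (Set β)} {T A : Set I} {z : I → Set β}
    (hz : Inv P 𝓕 T z) (hA : ∀ K ⊆ A, EE P 𝓕 K) : ∃ z', Inv P 𝓕 (T ∪ A) z' ∧ (∀ d, z' d ⊆ z d) ∧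
      ∀ d ∈ T, z' d = z d := by
  let Kd : I → Set I := fun d => {t | t ∈ A ∧ ¬ Sep T d t}
  have hKA : ∀ d, Kd d ⊆ A := fun d t ht => ht.1
  have hKK : ∀ d d', ¬ Sep T d d' → Kd d = Kd d' := by
    intro d d' h
    ext t
    constructor
    · rintro ⟨h1, h2⟩
      exact ⟨h1, fun h3 => h2 (Sep.of_not h h3)⟩
    · rintro ⟨h1, h2⟩
      exact ⟨h1, fun h3 => h2 (Sep.of_not (fun h' => h h'.symm) h3)⟩
  have hT : ∀ d d', ¬ Sep T d d' → d ∉ T := fun d d' h hd =>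
    h ⟨d, hd, (le_total d d').imp (fun h => ⟨le_rfl, h⟩) (fun h => ⟨h, le_rfl⟩)⟩
  have hself : ∀ d, d ∉ T → ¬ Sep T d d := by
    rintro d hd ⟨t, ht, h | h⟩
    · exact hd (le_antisymm h.1 h.2 ▸ ht)
    · exact hd (le_antisymm h.1 h.2 ▸ ht)
  have hex : ∀ (K : Set I) (J : Set β), ∃ z : I → Set β, K ⊆ A → J ∈ 𝓕 →
      Inv P 𝓕 K z ∧ ∀ d, z d ⊆ J := by
    intro K J
    by_cases hK : K ⊆ A ∧ J ∈ 𝓕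
    · obtain ⟨z, hz⟩ := hA K hK.1 J hK.2
      exact ⟨z, fun _ _ => hz⟩
    · exact ⟨fun _ => J, fun h1 h2 => absurd ⟨h1, h2⟩ hK⟩
  choose Z hZ using hex
  let z' : I → Set β := fun d => if d ∈ T then z d else Z (Kd d) (z d) d
  have hz'T : ∀ d ∈ T, z' d = z d := fun d hd => if_pos hd
  have hz'N : ∀ d, d ∉ T → z' d = Z (Kd d) (z d) d := fun d hd => if_neg hd
  have hsub : ∀ d, z' d ⊆ z d := by
    intro d
    by_cases hd : d ∈ T
    · rw [hz'T d hd]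
    · rw [hz'N d hd]
      exact (hZ _ _ (hKA d) (hz.f d hd)).2 d
  refine ⟨z', ⟨?_, ?_, ?_, ?_⟩, hsub, hz'T⟩
  · intro d hd
    by_cases hdT : d ∈ T
    · rw [hz'T d hdT]
      exact hz.p d hdT
    · rw [hz'N d hdT]
      exact (hZ _ _ (hKA d) (hz.f d hdT)).1.p d ⟨hd.resolve_left hdT, hself d hdT⟩
  · intro d hd
    have hdT : d ∉ T := fun h => hd (Or.inl h)
    rw [hz'N d hdT]
    exact (hZ _ _ (hKA d) (hz.f d hdT)).1.f d (fun h => hd (Or.inr h.1))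
  · rintro d d' hdd ⟨t, ht, hb⟩
    by_cases hs : Sep T d d'
    · exact (hz.l d d' hdd hs).mono (hsub _) (hsub _)
    · have hd := hT d d' hs
      have hd' := hT d' d (fun h => hs h.symm)
      rw [hz'N d hd, hz'N d' hd', ← hKK d d' hs, ← hz.e d d' hs]
      refine (hZ _ _ (hKA d) (hz.f d hd)).1.l d d' hdd ⟨t, ⟨?_, ?_⟩, hb⟩
      · exact ht.resolve_left (fun h => hs ⟨t, h, hb⟩)
      · rintro ⟨u, hu, hub⟩
        refine hs ⟨u, hu, ?_⟩
        have hb' : d ≤ t ∧ t ≤ d' := by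
          rcases hb with hb | hb
          · exact hb
          · exact absurd (hb.1.trans hb.2) (not_le.2 hdd)
        rcases hub with h | h
        · exact Or.inl ⟨h.1, h.2.trans hb'.2⟩
        · exact Or.inl ⟨hb'.1.trans h.1, (h.2.trans hb'.1).trans hb'.2⟩
  · intro d d' hs
    have hs1 : ¬ Sep T d d' := fun ⟨t, ht, hb⟩ => hs ⟨t, Or.inl ht, hb⟩
    have hd := hT d d' hs1
    have hd' := hT d' d (fun h => hs1 h.symm)
    rw [hz'N d hd, hz'N d' hd', ← hKK d d' hs1, ← hz.e d d' hs1]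
    refine (hZ _ _ (hKA d) (hz.f d hd)).1.e d d' ?_
    rintro ⟨t, ht, hb⟩
    exact hs ⟨t, Or.inr ht.1, hb⟩

lemma shuf_fusion {P : I → Set β → Prop} {𝓕 : Set (Set β)} (A : ℕ → Set I) (hA : ∀ x, ∃ n, x ∈ A n)
    (hE : ∀ n, ∀ K ⊆ A n, EE P 𝓕 K) (J : Set β) (hJ : J ∈ 𝓕) :
    ∃ z : I → Set β, (∀ d, z d ⊆ J ∧ P d (z d)) ∧ ∀ d d', d < d' → LL (z d) (z d') := by
  let Tn : ℕ → Set I := fun n => {x | ∃ m < n, x ∈ A m}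
  have hTs : ∀ n, Tn (n + 1) = Tn n ∪ A n := by
    intro n
    ext x
    constructor
    · rintro ⟨m, hm, hx⟩
      rcases Nat.lt_succ_iff_lt_or_eq.1 hm with h | rfl
      · exact Or.inl ⟨m, h, hx⟩
      · exact Or.inr hx
    · rintro (⟨m, hm, hx⟩ | hx)
      · exact ⟨m, hm.trans n.lt_succ_self, hx⟩
      · exact ⟨n, n.lt_succ_self, hx⟩
  have hstep : ∀ n (z : {z : I → Set β // Inv P 𝓕 (Tn n) z}),
      ∃ z' : {z : I → Set β // Inv P 𝓕 (Tn (n + 1)) z}, (∀ d, z'.1 d ⊆ z.1 d) ∧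
        ∀ d ∈ Tn n, z'.1 d = z.1 d := by
    rintro n ⟨z, hz⟩
    obtain ⟨z', h1, h2⟩ := hz.step (hE n)
    rw [← hTs] at h1
    exact ⟨⟨z', h1⟩, h2⟩
  choose nxt hn1 hn2 using hstep
  have hT0 : Tn 0 = ∅ := by
    rw [Set.eq_empty_iff_forall_notMem]
    rintro x ⟨m, hm, -⟩
    exact absurd hm (Nat.not_lt_zero _)
  obtain ⟨z0, hz0, hz0J⟩ := EE.empty (P := P) (𝓕 := 𝓕) J hJ
  rw [← hT0] at hz0
  let zs : ∀ n, {z : I → Set β // Inv P 𝓕 (Tn n) z} := fun n =>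
    Nat.rec ⟨z0, hz0⟩ (fun n z => nxt n z) n
  have hzs : ∀ n, zs (n + 1) = nxt n (zs n) := fun n => rfl
  have hsub : ∀ n d, (zs n).1 d ⊆ J := by
    intro n d
    induction n with
    | zero => exact hz0J d
    | succ n ih =>
      rw [hzs]
      exact (hn1 n (zs n) d).trans ih
  have hconst : ∀ n m d, n ≤ m → d ∈ Tn n → (zs m).1 d = (zs n).1 d := by
    intro n m d hnm hd
    induction m, hnm using Nat.le_induction with
    | base => rfl
    | succ m hm ih =>
      rw [hzs, hn2 m (zs m) d, ih]
      obtain ⟨k, hk, hx⟩ := hd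
      exact ⟨k, lt_of_lt_of_le hk hm, hx⟩
  choose N hN using hA
  have hNT : ∀ d, d ∈ Tn (N d + 1) := fun d => ⟨N d, Nat.lt_succ_self _, hN d⟩
  refine ⟨fun d => (zs (N d + 1)).1 d, fun d => ⟨hsub (N d + 1) d, (zs (N d + 1)).2.p d (hNT d)⟩, ?_⟩
  intro d d' hd
  show LL ((zs (N d + 1)).1 d) ((zs (N d' + 1)).1 d')
  rw [← hconst (N d + 1) (max (N d + 1) (N d' + 1)) d (le_max_left _ _) (hNT d),
    ← hconst (N d' + 1) (max (N d + 1) (N d' + 1)) d' (le_max_right _ _) (hNT d')]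
  refine (zs (max (N d + 1) (N d' + 1))).2.l d d' hd ⟨d, ?_, Or.inl ⟨le_rfl, hd.le⟩⟩
  exact ⟨N d, lt_of_lt_of_le (Nat.lt_succ_self _) (le_max_left _ _), hN d⟩

end shuf
end TSS


namespace TSS

lemma MidF.fin {α β : Type} [LinearOrder α] [LinearOrder β] {ι : Type} {P : ι → Set α → Prop}
    {P' : ι → Set β → Prop} {R : α → β → Prop} {𝓕 : Set (Set β)} (hm : ∀ j, MidF (P' j) 𝓕)
    (hPP : ∀ i M N, P i M → P' i N → Emb R M N) {A : Set α} (h : FinB P A) :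
    A = ∅ ∨ MidF (fun N => Emb R A N) 𝓕 := by
  refine h.ind (fun A => A = ∅ ∨ MidF (fun N => Emb R A N) 𝓕) (Or.inl rfl) ?_ ?_
  · rintro A B hAB (rfl | hA) (rfl | hB)
    · left; simp
    · right; simpa using hB
    · right; simpa using hA
    · right
      intro J hJ
      obtain ⟨J0, h0, J1, h1, C, a, b, c, d, e, f, g⟩ := hA J hJ
      obtain ⟨J0', h0', J1', h1', C', a', b', c', d', e', f', g'⟩ := hB J1 h1
      refine ⟨J0, h0, J1', h1', C ∪ C', a, b'.trans b, Set.union_subset c (c'.trans b), ?_, ?_, ?_,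
        Emb.union hAB (e.mono subset_rfl c') g g'⟩
      · rintro x hx y (hy | hy)
        · exact d x hx y hy
        · exact f x hx y (c' hy)
      · rintro x (hx | hx) y hy
        · exact e x hx y (b' hy)
        · exact e' x hx y hy
      · exact f.mono subset_rfl b'
  · intro i M hM
    right
    intro J hJ
    obtain ⟨J0, h0, J1, h1, C, a, b, c, d, e, f, g⟩ := hm i J hJ
    exact ⟨J0, h0, J1, h1, C, a, b, c, d, e, f, hPP i M C hM g⟩

theorem shuf_comp {α β : Type} [loA : LinearOrder α] [loB : LinearOrder β] {ι : Type}
    {a b : Ordinal.{0}}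
    {P : ι → Set α → Prop} {P' : ι → Set β → Prop} {A : Set α} {B : Set β} (R : α → β → Prop)
    (hU : UpShuf a b P A) (hD : DnShuf a b P' B) (hPP : ∀ i M N, P i M → P' i N → Emb R M N) :
    Emb R A B := by
  obtain ⟨𝓒, hC, rfl, hfin, ⟨As, hAs, hsc⟩, hno, hno'⟩ := hU
  obtain ⟨𝓕, ⟨J, hJ, hJB⟩, hinc, hinc', hmid⟩ := hD
  letI loI : LinearOrder (El 𝓒) := hC.lo
  have hlt : ∀ c d : El 𝓒, c < d ↔ LL c.1 d.1 := fun c d => Iff.rfl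
  have hI : NoI (El 𝓒) a := by
    rintro ⟨g, hg⟩
    exact hno ⟨fun ξ => (g ξ).1, fun ξ _ => (g ξ).2, fun ξ ζ h1 h2 => hg ξ ζ h1 h2⟩
  have hI' : @NoI (El 𝓒) (dualLO loI) b := by
    rintro ⟨g, hg⟩
    exact hno' ⟨fun ξ => (g ξ).1, fun ξ _ => (g ξ).2, fun ξ ζ h1 h2 => LL.dual.2 (hg ξ ζ h1 h2)⟩
  have hm : ∀ d : El 𝓒, MidF (fun N => Emb R d.1 N) 𝓕 := by
    intro d
    rcases MidF.fin hmid hPP (hfin d.1 d.2) with h | h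
    · exact absurd h (hC.ne _ d.2).ne_empty
    · exact h
  have hcond := cond_EE (P := fun (d : El 𝓒) N => Emb R d.1 N) hI hI' hinc hinc' hm
  obtain ⟨z, hz1, hz2⟩ := shuf_fusion (P := fun (d : El 𝓒) N => Emb R d.1 N) (𝓕 := 𝓕)
    (fun n => {d : El 𝓒 | d.1 ∈ As n}) (fun d => hAs d.1 d.2) (fun n => by
      refine hcond.scattered_sub _ ?_
      rintro ⟨f, hf⟩
      exact hsc n ⟨fun q => (f q).1.1, fun q => ⟨(f q).1.2, (f q).2⟩, fun p q hpq => hf hpq⟩) J hJ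
  refine Emb.glue (I := El 𝓒) (fun d => d.1) z ?_ (fun i j h => h) (fun d => (hz1 d).1.trans hJB)
    hz2 (fun d => (hz1 d).2)
  rintro x ⟨C, hC, hx⟩
  exact Set.mem_iUnion.2 ⟨⟨C, hC⟩, hx⟩

universe u

theorem comp {α β : Type} [loA : LinearOrder α] [loB : LinearOrder β] {Q : Type u}
    {r : Q → Q → Prop} (ht : Transitive r) (l : α → Q) (l' : β → Q) (h : Code Q) :
    ∀ (A : Set α) (B : Set β), Up r l h A → Dn r l' h B → Emb (fun x y => r (l x) (l' y)) A B := by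
  induction h with
  | leaf q =>
    rintro A B ⟨hs, hA⟩ ⟨y, hy, hB⟩
    exact ⟨fun _ => y, fun x => ⟨hy, ht (hA x.1 x.2) hB⟩, fun x x' hx =>
      absurd (hs x.2 x'.2) hx.ne⟩
  | node k a b ι f ih =>
    intro A B hA hB
    match k with
    | 0 => exact sum_comp _ hA hB ih
    | 1 =>
      refine Emb.dual.1 (@sum_comp α β (dualLO loA) (dualLO loB) ι a (fun i => Up r l (f i))
        (fun i => Dn r l' (f i)) A B _ hA hB ?_)
      intro i M N h1 h2
      exact Emb.dual.2 (ih i M N h1 h2)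
    | 2 => exact shuf_comp _ hA hB ih

end TSS


namespace TSS

open Cardinal

universe u

/-- convex sets -/
def Cv {α : Type} [LinearOrder α] (K : Set α) : Prop := ∀ x ∈ K, ∀ y ∈ K, ∀ z, x ≤ z → z ≤ y → z ∈ K

lemma Cv.dual {α : Type} [lo : LinearOrder α] {K : Set α} : @Cv α (dualLO lo) K ↔ Cv K :=
  ⟨fun h x hx y hy z h1 h2 => h y hy x hx z h2 h1, fun h x hx y hy z h1 h2 => h y hy x hx z h2 h1⟩

lemma FinB.of_dual {α : Type} [lo : LinearOrder α] {ι : Type*} {P : ι → Set α → Prop} {A : Set α}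
    (h : @FinB α (dualLO lo) ι P A) : FinB P A := by
  obtain ⟨𝓜, h1, h2, h3, h4⟩ := h
  refine ⟨𝓜, h1, ⟨@Ch.ne α (dualLO lo) _ h2, fun B hB B' hB' => ?_⟩, h3, h4⟩
  rcases @Ch.tot α (dualLO lo) _ h2 B hB B' hB' with h | h | h
  · exact Or.inl h
  · exact Or.inr (Or.inr (LL.dual.1 h))
  · exact Or.inr (Or.inl (LL.dual.1 h))

lemma sum_piece {α : Type} [lo : LinearOrder α] {Cd : Type u} (le : Cd → Cd → Prop)
    (hw : ∀ e : ℕ → Cd, ∃ m n, m < n ∧ le (e m) (e n)) (U D : Cd → Set α → Prop)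
    (hDm : ∀ h A B, A ⊆ B → D h A → D h B) (hDl : ∀ h g, le h g → ∀ A, D g A → D h A)
    (hnode : ∀ (a : Ordinal.{0}) (ι : Type) (f : ι → Cd) (T : Set α),
      UpSum a (fun i => U (f i)) T → DnSum a (fun i => D (f i)) T → ∃ h, U h T ∧ D h T)
    (K : Set α) (hcv : Cv K)
    (hK : ∀ x ∈ K, ∀ K' ⊆ K, (∀ y ∈ K', y ≤ x) → Cv K' → FinB (fun h M => U h M ∧ D h M) K') :
    FinB (fun h M => U h M ∧ D h M) K := by
  obtain ⟨κ, S, hSK, hcof, hwf, hcard, hbd⟩ := exists_cof K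
  by_cases hmax : ∃ x ∈ K, ∀ y ∈ K, y ≤ x
  · obtain ⟨x, hx, hy⟩ := hmax
    exact hK x hx K subset_rfl hy hcv
  push Not at hmax
  rcases S.eq_empty_or_nonempty with rfl | ⟨x0, hx0⟩
  · have : K = ∅ := by
      rw [Set.eq_empty_iff_forall_notMem]
      intro x hx
      obtain ⟨s, hs, -⟩ := hcof x hx
      exact hs
    rw [this]
    exact FinB.empty _
  have hgt : ∀ x ∈ K, ∃ s ∈ S, x < s := by
    intro x hx
    obtain ⟨y, hy, hxy⟩ := hmax x hx
    obtain ⟨s, hs, h⟩ := hcof y hy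
    exact ⟨s, hs, hxy.trans_le h⟩
  let C : α → Set α := fun s => {y | y ∈ K ∧ y ≤ s ∧ ∀ t ∈ S, t < s → t < y}
  have hCs : ∀ s ∈ S, s ∈ C s := fun s hs => ⟨hSK hs, le_rfl, fun t _ h => h⟩
  have hCK : ∀ s, C s ⊆ K := fun s y hy => hy.1
  have hCcov : ∀ y ∈ K, ∃ s ∈ S, y ∈ C s := by
    intro y hy
    obtain ⟨s, hs, hys⟩ := hcof y hy
    obtain ⟨t, ht, hmin⟩ := hwf {t | t ∈ S ∧ y ≤ t} (fun t ht => ht.1) ⟨s, hs, hys⟩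
    refine ⟨t, ht.1, hy, ht.2, fun t' ht' hlt => ?_⟩
    by_contra hc
    exact absurd (hmin t' ⟨ht', not_lt.1 hc⟩) (not_le.2 hlt)
  have hCL : ∀ s ∈ S, ∀ t ∈ S, s < t → LL (C s) (C t) := by
    intro s hs t ht hst x hx y hy
    exact lt_of_le_of_lt hx.2.1 (hy.2.2 s hs hst)
  have hCinj : ∀ s ∈ S, ∀ t ∈ S, C s = C t → s = t := by
    intro s hs t ht he
    have h1 : s ∈ C t := he ▸ hCs s hs
    have h2 : t ∈ C s := he ▸ hCs t ht
    exact le_antisymm h1.2.1 h2.2.1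
  have hCLL : ∀ s ∈ S, ∀ t ∈ S, LL (C s) (C t) → s < t := fun s hs t ht h =>
    h s (hCs s hs) t (hCs t ht)
  have hFS : ∀ s : S, FinB (fun h M => U h M ∧ D h M) (C s.1) := by
    intro s
    refine hK s.1 (hSK s.2) _ (hCK _) (fun y hy => hy.2.1) ?_
    intro x hx y hy z h1 h2
    exact ⟨hcv x hx.1 y hy.1 z h1 h2, h2.trans hy.2.1, fun t ht hts => (hx.2.2 t ht hts).trans_le h1⟩
  choose 𝓜 hM1 hM2 hM3 hM4 using hFS
  choose cd hcd using hM4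
  let bad : Cd → Prop := fun h => ∃ t ∈ S, ∀ t' ∈ S, t < t' → ¬ D h (C t')
  have hs0 : ∃ s0 : S, ∀ s : S, s0 ≤ s → ∀ M hM, ¬ bad (cd s M hM) := by
    by_contra hcon
    push Not at hcon
    have step : ∀ t : S, ∃ (t' : S) (h : Cd) (s : S), t < s ∧ D h (C s.1) ∧ t ≤ t' ∧
        ∀ t'' ∈ S, t'.1 < t'' → ¬ D h (C t'') := by
      intro t
      obtain ⟨t1, ht1, ht1'⟩ := hgt t.1 (hSK t.2)
      obtain ⟨s, hs, M, hM, t2, ht2, hb⟩ := hcon ⟨t1, ht1⟩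
      refine ⟨max t ⟨t2, ht2⟩, cd s M hM, s, lt_of_lt_of_le (show t < ⟨t1, ht1⟩ from ht1') hs,
        hDm _ _ _ ?_ (hcd s M hM).2, le_max_left _ _, fun t'' h1 h2 => hb t'' h1 ?_⟩
      · rw [← hM3 s]
        exact Set.subset_sUnion_of_mem hM
      · refine lt_of_le_of_lt ?_ h2
        exact (le_max_right t ⟨t2, ht2⟩ : (⟨t2, ht2⟩ : S) ≤ _)
    choose nx hh ss h1 h2 h3 h4 using step
    let tt : ℕ → S := fun n => Nat.rec ⟨x0, hx0⟩ (fun _ t => nx t) n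
    have htt : ∀ n, tt (n + 1) = nx (tt n) := fun n => rfl
    have hmono : Monotone tt := monotone_nat_of_le_succ fun n => h3 (tt n)
    obtain ⟨m, n, hmn, hle⟩ := hw (fun n => hh (tt n))
    refine h4 (tt m) (ss (tt n)).1 (ss (tt n)).2 ?_ (hDl _ _ hle _ (h2 (tt n)))
    exact lt_of_le_of_lt (hmono (Nat.succ_le_of_lt hmn)) (h1 (tt n))
  obtain ⟨s0, hs0⟩ := hs0
  let ι : Type := {p : S × Set α // s0 ≤ p.1 ∧ p.2 ∈ 𝓜 p.1}
  let f : ι → Cd := fun p => cd p.1.1 p.1.2 p.2.2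
  let 𝓒 : Set (Set α) := {X | ∃ s : S, s0 ≤ s ∧ X = C s.1}
  have h𝓒 : Ch 𝓒 := by
    constructor
    · rintro _ ⟨s, -, rfl⟩
      exact ⟨s.1, hCs s.1 s.2⟩
    · rintro _ ⟨s, -, rfl⟩ _ ⟨t, -, rfl⟩
      rcases lt_trichotomy s.1 t.1 with h | h | h
      · exact Or.inr (Or.inl (hCL _ s.2 _ t.2 h))
      · left; rw [h]
      · exact Or.inr (Or.inr (hCL _ t.2 _ s.2 h))
  have hup : UpSum κ.ord (fun i => U (f i)) (⋃₀ 𝓒) := by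
    refine ⟨𝓒, h𝓒, rfl, ?_, ?_, ?_⟩
    · rintro _ ⟨s, hs, rfl⟩
      exact ⟨𝓜 s, hM1 s, hM2 s, hM3 s, fun M hM => ⟨⟨(s, M), hs, hM⟩, (hcd s M hM).1⟩⟩
    · rintro X hX ⟨x, hx⟩
      obtain ⟨s, hs, rfl⟩ := hX hx
      obtain ⟨t, ht, hmin⟩ := hwf {t | t ∈ S ∧ C t ∈ X} (fun t ht => ht.1) ⟨s, s.2, hx⟩
      refine ⟨C t, ht.2, fun C' hC' hLL => ?_⟩
      obtain ⟨s', hs', rfl⟩ := hX hC'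
      exact absurd (hmin s'.1 ⟨s'.2, hC'⟩) (not_le.2 (hCLL _ s'.2 _ ht.1 hLL))
    · rintro _ ⟨s, hs, rfl⟩
      rw [Cardinal.card_ord]
      refine lt_of_le_of_lt ?_ (hcard s.1 s.2)
      have hex : ∀ X : {C' // C' ∈ 𝓒 ∧ LL C' (C s.1)}, ∃ t : {t // t ∈ S ∧ t < s.1}, X.1 = C t.1 := by
        rintro ⟨_, ⟨t, ht, rfl⟩, h⟩
        exact ⟨⟨t.1, t.2, hCLL _ t.2 _ s.2 h⟩, rfl⟩
      choose g hg using hex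
      refine Cardinal.mk_le_of_injective (f := g) ?_
      intro X Y hXY
      apply Subtype.ext
      rw [hg X, hg Y, hXY]
  have hdn : DnSum κ.ord (fun i => D (f i)) (⋃₀ 𝓒) := by
    refine ⟨𝓒, h𝓒, ⟨C s0.1, s0, le_rfl, rfl⟩, fun W hW => Set.subset_sUnion_of_mem hW, ?_, ?_⟩
    · intro S' hS' hlt
      rw [Cardinal.card_ord] at hlt
      have h1 : #{t | t ∈ S ∧ C t ∈ S'} < κ := by
        refine lt_of_le_of_lt ?_ hlt
        refine Cardinal.mk_le_of_injective (f := fun t => ⟨C t.1, t.2.2⟩) ?_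
        intro t t' htt
        apply Subtype.ext
        refine hCinj _ t.2.1 _ t'.2.1 ?_
        have := congrArg Subtype.val htt
        exact this
      obtain ⟨y, hy, hyb⟩ := hbd _ (fun t ht => hSK ht.1) h1
      obtain ⟨s, hs, hys⟩ := hcof y hy
      refine ⟨C (max s0 ⟨s, hs⟩ : S).1, ⟨_, le_max_left _ _, rfl⟩, fun X hX => ?_⟩
      obtain ⟨t, ht, rfl⟩ := hS' hX
      refine hCL _ t.2 _ (max s0 ⟨s, hs⟩ : S).2 ?_
      refine lt_of_lt_of_le (hyb t.1 ⟨t.2, hX⟩) (hys.trans ?_)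
      exact (le_max_right s0 ⟨s, hs⟩ : (⟨s, hs⟩ : S) ≤ _)
    · rintro ⟨⟨s, M⟩, hs, hM⟩ _ ⟨t, ht, rfl⟩
      have h1 := hs0 s hs M hM
      have h2 : ∃ t' ∈ S, t.1 < t' ∧ D (cd s M hM) (C t') := by
        by_contra hc
        push Not at hc
        exact h1 ⟨t.1, t.2, hc⟩
      obtain ⟨t', ht', h3, h4⟩ := h2
      exact ⟨C t', ⟨⟨t', ht'⟩, ht.trans h3.le, rfl⟩, hCL _ t.2 _ ht' h3, h4⟩
  obtain ⟨h, hh⟩ := hnode _ _ f _ hup hdn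
  let K0 : Set α := {y | y ∈ K ∧ ∃ t ∈ S, t < s0.1 ∧ y ≤ t}
  have hK0 : FinB (fun h M => U h M ∧ D h M) K0 := by
    refine hK s0.1 (hSK s0.2) K0 (fun y hy => hy.1) ?_ ?_
    · rintro y ⟨-, t, -, h1, h2⟩
      exact h2.trans h1.le
    · rintro x ⟨hx, -⟩ y ⟨hy, t, ht, h1, h2⟩ z h3 h4
      exact ⟨hcv x hx y hy z h3 h4, t, ht, h1, h4.trans h2⟩
  have e : K = K0 ∪ ⋃₀ 𝓒 := by
    ext y
    constructor
    · intro hy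
      obtain ⟨s, hs, hys⟩ := hCcov y hy
      rcases lt_or_ge s s0.1 with h | h
      · exact Or.inl ⟨hy, s, hs, h, hys.2.1⟩
      · exact Or.inr ⟨C s, ⟨⟨s, hs⟩, h, rfl⟩, hys⟩
    · rintro (hy | ⟨_, ⟨s, hs, rfl⟩, hy⟩)
      · exact hy.1
      · exact hy.1
  rw [e]
  refine hK0.union (FinB.single h hh) ?_
  rintro y ⟨-, t, ht, h1, h2⟩ z ⟨_, ⟨s, hs, rfl⟩, hz⟩
  exact lt_of_le_of_lt h2 (hz.2.2 t ht (h1.trans_le hs))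

end TSS


namespace TSS

open Cardinal

universe u

section homog

variable {α : Type} [lo : LinearOrder α] (Bg : Set α → Prop)

/-- increasing sequences of big sets -/
def BSeq (J : Set α) (δ : Ordinal.{0}) : Prop :=
  ∃ s : Ordinal.{0} → Set α, (∀ ξ < δ, Bg (s ξ) ∧ s ξ ⊆ J) ∧ ∀ ξ ζ, ξ < ζ → ζ < δ → LL (s ξ) (s ζ)

/-- least length which does not occur -/
noncomputable def aO (J : Set α) : Ordinal.{0} := sInf {δ | ¬ BSeq Bg J δ}

variable {Bg}

lemma BSeq.mono {J J' : Set α} {δ δ' : Ordinal.{0}} (h : BSeq Bg J δ) (hJ : J ⊆ J') (hd : δ' ≤ δ) :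
    BSeq Bg J' δ' := by
  obtain ⟨s, h1, h2⟩ := h
  exact ⟨s, fun ξ hξ => ⟨(h1 ξ (hξ.trans_le hd)).1, (h1 ξ (hξ.trans_le hd)).2.trans hJ⟩,
    fun ξ ζ h h' => h2 ξ ζ h (h'.trans_le hd)⟩

lemma BSeq.bdd (hne : ∀ J, Bg J → J.Nonempty) (J : Set α) : {δ | ¬ BSeq Bg J δ}.Nonempty := by
  refine ⟨(Order.succ #α).ord, ?_⟩
  rintro ⟨s, h1, h2⟩
  have h3 : ∀ x : (Order.succ #α).ord.ToType,
      Ordinal.typein ((· < ·) : (Order.succ #α).ord.ToType → _ → Prop) x < (Order.succ #α).ord :=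
    fun x => Ordinal.typein_lt_self x
  choose p hp using fun x => hne _ (h1 _ (h3 x)).1
  have hinj : Function.Injective p := by
    intro x y hxy
    by_contra hne'
    rcases lt_or_gt_of_ne hne' with h | h
    · have := h2 _ _ ((Ordinal.typein_lt_typein (· < ·)).2 h) (h3 y) _ (hp x) _ (hp y)
      exact absurd hxy this.ne
    · have := h2 _ _ ((Ordinal.typein_lt_typein (· < ·)).2 h) (h3 x) _ (hp y) _ (hp x)
      exact absurd hxy this.ne'
  have := Cardinal.mk_le_of_injective hinj
  rw [Cardinal.mk_toType, Cardinal.card_ord] at this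
  exact absurd this (not_le.2 (Order.lt_succ _))

lemma aO_not (hne : ∀ J, Bg J → J.Nonempty) (J : Set α) : ¬ BSeq Bg J (aO Bg J) :=
  csInf_mem (BSeq.bdd hne J)

lemma aO_lt {J : Set α} {δ : Ordinal.{0}} (h : δ < aO Bg J) : BSeq Bg J δ := by
  by_contra hc
  exact absurd (csInf_le' (s := {δ | ¬ BSeq Bg J δ}) hc) (not_le.2 h)

lemma lt_aO (hne : ∀ J, Bg J → J.Nonempty) {J : Set α} {δ : Ordinal.{0}} (h : BSeq Bg J δ) :
    δ < aO Bg J := by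
  by_contra hc
  exact aO_not hne J (h.mono subset_rfl (not_lt.1 hc))

lemma aO_incF (hne : ∀ J, Bg J → J.Nonempty)
    (hsp : ∀ J, Bg J → ∃ J0 J1, Bg J0 ∧ Bg J1 ∧ J0 ⊆ J ∧ J1 ⊆ J ∧ LL J0 J1) {J : Set α}
    (hJ : ∀ J' ⊆ J, Bg J' → ¬ aO Bg J' < aO Bg J) :
    IncF (aO Bg J) {J' | Bg J' ∧ J' ⊆ J} := by
  rintro J' ⟨hB, hJ'⟩ δ hδ
  obtain ⟨J0, J1, h0, h1, h2, h3, h4⟩ := hsp J' hB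
  obtain ⟨s, hs1, hs2⟩ := aO_lt (hδ.trans_le (not_lt.1 (hJ J0 (h2.trans hJ') h0)))
  refine ⟨s, J1, ⟨h1, h3.trans hJ'⟩, h3, fun ξ hξ => ⟨⟨(hs1 ξ hξ).1, ?_⟩, ?_, ?_⟩, hs2⟩
  · exact (hs1 ξ hξ).2.trans (h2.trans hJ')
  · exact (hs1 ξ hξ).2.trans h2
  · exact h4.mono (hs1 ξ hξ).2 subset_rfl

lemma aO_succ (hne : ∀ J, Bg J → J.Nonempty)
    (hsp : ∀ J, Bg J → ∃ J0 J1, Bg J0 ∧ Bg J1 ∧ J0 ⊆ J ∧ J1 ⊆ J ∧ LL J0 J1) {J : Set α} (hB : Bg J)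
    (hJ : ∀ J' ⊆ J, Bg J' → ¬ aO Bg J' < aO Bg J) {δ : Ordinal.{0}} (hδ : δ < aO Bg J) :
    δ + 1 < aO Bg J := by
  apply lt_aO hne
  obtain ⟨s, top, h1, h2, h3, h4⟩ := aO_incF hne hsp hJ J ⟨hB, subset_rfl⟩ δ hδ
  classical
  refine ⟨fun ξ => if ξ < δ then s ξ else top, ?_, ?_⟩
  · intro ξ hξ
    dsimp only
    split_ifs with h
    · exact (h3 ξ h).1
    · exact h1
  · intro ξ ζ hξ hζ
    have h5 : ξ < δ := hξ.trans_le (Order.lt_add_one_iff.1 hζ)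
    dsimp only
    rw [if_pos h5]
    split_ifs with h
    · exact h4 ξ ζ hξ h
    · exact (h3 ξ h5).2.2

lemma aO_noInc (hne : ∀ J, Bg J → J.Nonempty)
    (hsp : ∀ J, Bg J → ∃ J0 J1, Bg J0 ∧ Bg J1 ∧ J0 ⊆ J ∧ J1 ⊆ J ∧ LL J0 J1) {J : Set α} (hB : Bg J)
    (hJ : ∀ J' ⊆ J, Bg J' → ¬ aO Bg J' < aO Bg J) (E : α → α → Prop)
    (hd : ∀ x ∈ J, ∀ y ∈ J, x < y → ¬ E x y → ∃ B, Bg B ∧ B ⊆ J ∧ ∀ t ∈ B, x ≤ t ∧ t < y)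
    (𝓒 : Set (Set α)) (hC : ∀ C ∈ 𝓒, C.Nonempty ∧ C ⊆ J)
    (hE : ∀ C ∈ 𝓒, ∀ C' ∈ 𝓒, LL C C' → ∀ x ∈ C, ∀ y ∈ C', ¬ E x y) : NoInc (aO Bg J) 𝓒 := by
  rintro ⟨g, hg1, hg2⟩
  apply aO_not hne J
  obtain ⟨x0, hx0⟩ := hne J hB
  have hx : ∀ ξ, ∃ x, ξ < aO Bg J → x ∈ g ξ := by
    intro ξ
    by_cases h : ξ < aO Bg J
    · obtain ⟨x, hx⟩ := (hC _ (hg1 ξ h)).1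
      exact ⟨x, fun _ => hx⟩
    · exact ⟨x0, fun h' => absurd h' h⟩
  choose x hx using hx
  have hs : ∀ ξ, ∃ B, ξ < aO Bg J → Bg B ∧ B ⊆ J ∧ ∀ t ∈ B, x ξ ≤ t ∧ t < x (ξ + 1) := by
    intro ξ
    by_cases h : ξ < aO Bg J
    · have h' := aO_succ hne hsp hB hJ h
      have hlt : ξ < ξ + 1 := Order.lt_add_one_iff.2 le_rfl
      have hLL := hg2 ξ (ξ + 1) hlt h'
      obtain ⟨B, hB⟩ := hd (x ξ) ((hC _ (hg1 ξ h)).2 (hx ξ h)) (x (ξ + 1))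
        ((hC _ (hg1 _ h')).2 (hx _ h')) (hLL _ (hx ξ h) _ (hx _ h'))
        (hE _ (hg1 ξ h) _ (hg1 _ h') hLL _ (hx ξ h) _ (hx _ h'))
      exact ⟨B, fun _ => hB⟩
    · exact ⟨∅, fun h' => absurd h' h⟩
  choose s hs using hs
  refine ⟨s, fun ξ hξ => ⟨(hs ξ hξ).1, (hs ξ hξ).2.1⟩, fun ξ ζ h1 h2 t ht u hu => ?_⟩
  have h3 := ((hs ξ (h1.trans h2)).2.2 t ht).2
  have h4 := ((hs ζ h2).2.2 u hu).1
  have h5 : x (ξ + 1) ≤ x ζ := by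
    rcases (Order.add_one_le_iff.2 h1).lt_or_eq with h | h
    · exact (hg2 _ _ h h2 _ (hx _ (h.trans h2)) _ (hx _ h2)).le
    · rw [h]
  exact (h3.trans_le h5).trans_le h4

lemma aO_mono (hne : ∀ J, Bg J → J.Nonempty) {J J' : Set α} (h : J' ⊆ J) : aO Bg J' ≤ aO Bg J := by
  by_contra hc
  exact aO_not hne J ((aO_lt (not_le.1 hc)).mono h le_rfl)

end homog

lemma wf_min {α : Type} (Bg : Set α → Prop) (rel : Set α → Set α → Prop) (hwf : WellFounded rel)
    (J : Set α) (hJ : Bg J) : ∃ J1 ⊆ J, Bg J1 ∧ ∀ J' ⊆ J1, Bg J' → ¬ rel J' J1 := by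
  let X : Set (Set α) := {J' | J' ⊆ J ∧ Bg J'}
  have hX : X.Nonempty := ⟨J, subset_rfl, hJ⟩
  have h := hwf.min_mem X hX
  exact ⟨hwf.min X hX, h.1, h.2, fun J' h1 h2 h3 => hwf.not_lt_min X (x := J') ⟨h1.trans h.1, h2⟩ h3⟩

section dec

variable {α : Type} [lo : LinearOrder α] {Q : Type u} (r : Q → Q → Prop) (l : α → Q)

/-- finite sums of pieces -/
def FS (A : Set α) : Prop := FinB (fun h M => Up r l h M ∧ Dn r l h M) A

/-- hereditary version -/
def GG (K : Set α) : Prop := ∀ K' ⊆ K, Cv K' → FS r l K'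

variable {r}

lemma cond_GG (hr : Reflexive r) (ht : Transitive r)
    (hw : ∀ e : ℕ → Code Q, ∃ m n, m < n ∧ Le r (e m) (e n)) : Cond (GG r l) where
  mono A B hAB hB K' hK' := hB K' (hK'.trans hAB)
  single x K' hK' hcv := by
    rcases Set.subset_singleton_iff_eq.1 hK' with rfl | rfl
    · exact FinB.empty _
    · refine FinB.single (.leaf (l x)) ⟨⟨Set.subsingleton_singleton, ?_⟩, x, rfl, hr _⟩
      rintro y rfl
      exact hr _
  add A B hAB hA hB K' hK' hcv := by
    have : K' = (K' ∩ A) ∪ (K' ∩ B) := by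
      rw [← Set.inter_union_distrib_left]
      exact (Set.inter_eq_left.2 hK').symm
    rw [this]
    refine FinB.union (hA _ Set.inter_subset_right ?_) (hB _ Set.inter_subset_right ?_)
      (hAB.mono Set.inter_subset_right Set.inter_subset_right)
    · rintro x ⟨hx, hxA⟩ y ⟨hy, hyA⟩ z h1 h2
      have hz := hcv x hx y hy z h1 h2
      refine ⟨hz, (hK' hz).resolve_right fun hzB => ?_⟩
      exact absurd (hAB y hyA z hzB) (not_lt.2 h2)
    · rintro x ⟨hx, hxB⟩ y ⟨hy, hyB⟩ z h1 h2
      have hz := hcv x hx y hy z h1 h2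
      refine ⟨hz, (hK' hz).resolve_left fun hzA => ?_⟩
      exact absurd (hAB z hzA x hxB) (not_lt.2 h1)
  plus K hK K' hK' hcv := by
    refine sum_piece (Le r) hw (Up r l) (Dn r l) (fun h A B hAB hA => hA.mono (hB := hAB))
      (fun h g hle A hA => Dn.le l ht hle A hA)
      (fun a ι f T h1 h2 => ⟨.node 0 a 0 ι f, h1, h2⟩) K' hcv ?_
    intro x hx K'' hK'' hle hcv''
    exact hK x (hK' hx) K'' (fun y hy => ⟨hK' (hK'' hy), hle y hy⟩) hcv''
  minus K hK K' hK' hcv := by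
    refine FinB.of_dual (@sum_piece α (dualLO lo) _ (Le r) hw (Up r l) (Dn r l)
      (fun h A B hAB hA => hA.mono (hB := hAB))
      (fun h g hle A hA => Dn.le l ht hle A hA)
      (fun a ι f T h1 h2 => ⟨.node 1 a 0 ι f, h1, h2⟩) K' (Cv.dual.2 hcv) ?_)
    intro x hx K'' hK'' hle hcv''
    exact FinB.dual (hK x (hK' hx) K'' (fun y hy => ⟨hK' (hK'' hy), hle y hy⟩) (Cv.dual.1 hcv''))

end dec
end TSS


namespace TSS

open Cardinal

universe u

variable {α : Type} [lo : LinearOrder α] {Q : Type u} {r : Q → Q → Prop} (l : α → Q)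

lemma dn_wf (ht : Transitive r) (hw : ∀ e : ℕ → Code Q, ∃ m n, m < n ∧ Le r (e m) (e n)) :
    WellFounded (fun J' J : Set α => J' ⊆ J ∧ ∃ h, Dn r l h J ∧ ¬ Dn r l h J') := by
  rw [wellFounded_iff_isEmpty_descending_chain]
  refine ⟨?_⟩
  rintro ⟨s, hs⟩
  have hanti : ∀ m n, m ≤ n → s n ⊆ s m := by
    intro m n hmn
    induction n, hmn using Nat.le_induction with
    | base => exact subset_rfl
    | succ n _ ih => exact (hs n).1.trans ih
  choose h1 h h2 h3 using hs
  obtain ⟨m, n, hmn, hle⟩ := hw h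
  exact h3 m ((Dn.le l ht hle _ (h2 n)).mono (hB := hanti _ _ hmn))

/-- big convex sets -/
def Bg (G : Set α → Prop) (J : Set α) : Prop := Cv J ∧ ∃ x ∈ J, ∃ y ∈ J, x < y ∧ ¬ G (btw x y)

lemma Bg.ne {G : Set α → Prop} (J : Set α) (h : Bg G J) : J.Nonempty := by
  obtain ⟨-, x, hx, -⟩ := h
  exact ⟨x, hx⟩

lemma btw_Bg {G : Set α → Prop} {x y : α} (hxy : x < y) (hn : ¬ G (btw x y)) : Bg G (btw x y) := by
  have hb : ∀ z, z ∈ btw x y ↔ x ≤ z ∧ z ≤ y := by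
    intro z
    constructor
    · rintro (h | h)
      · exact h
      · exact absurd (h.1.trans h.2) (not_le.2 hxy)
    · exact Or.inl
  refine ⟨?_, x, (hb x).2 ⟨le_rfl, hxy.le⟩, y, (hb y).2 ⟨hxy.le, le_rfl⟩, hxy, hn⟩
  intro a ha b hb' z h1 h2
  rw [hb] at ha hb' ⊢
  exact ⟨ha.1.trans h1, h2.trans hb'.2⟩

lemma btw_lt {x y z : α} (hxy : x < y) (hz : z ∈ btw x y) : x ≤ z ∧ z ≤ y := by
  rcases hz with h | h
  · exact h
  · exact absurd (h.1.trans h.2) (not_le.2 hxy)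

lemma btw_cv {J : Set α} (hJ : Cv J) {x y : α} (hx : x ∈ J) (hy : y ∈ J) : btw x y ⊆ J := by
  rintro z (h | h)
  · exact hJ x hx y hy z h.1 h.2
  · exact hJ y hy x hx z h.1 h.2

lemma Bg.split {G : Set α → Prop} (hG : Cond G) (J : Set α) (hJ : Bg G J) :
    ∃ J0 J1, Bg G J0 ∧ Bg G J1 ∧ J0 ⊆ J ∧ J1 ⊆ J ∧ LL J0 J1 := by
  obtain ⟨hcv, x, hx, y, hy, hxy, hn⟩ := hJ
  obtain ⟨z, h1, h2, h3, h4⟩ := hG.dense hxy hn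
  obtain ⟨w, g1, g2, g3, g4⟩ := hG.dense h1 h3
  have hz : z ∈ J := hcv x hx y hy z h1.le h2.le
  have hw : w ∈ J := hcv x hx z hz w g1.le g2.le
  refine ⟨btw x w, btw z y, btw_Bg g1 g3, btw_Bg h2 h4, btw_cv hcv hx hw, btw_cv hcv hz hy, ?_⟩
  intro a ha b hb
  exact lt_of_le_of_lt (btw_lt g1 ha).2 (g2.trans_le (btw_lt h2 hb).1)

theorem homog_FS (hr : Reflexive r) (ht : Transitive r)
    (hw : ∀ e : ℕ → Code Q, ∃ m n, m < n ∧ Le r (e m) (e n)) (hα : IsSigmaScattered α)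
    (J : Set α) (hJ : Bg (GG r l) J)
    (ha : ∀ J' ⊆ J, Bg (GG r l) J' → ¬ aO (Bg (GG r l)) J' < aO (Bg (GG r l)) J)
    (hb : ∀ J' ⊆ J, Bg (GG r l) J' → ¬ @aO α (dualLO lo) (Bg (GG r l)) J' <
      @aO α (dualLO lo) (Bg (GG r l)) J)
    (hD : ∀ J' ⊆ J, Bg (GG r l) J' → ∀ h, Dn r l h J → Dn r l h J') : FS r l J := by
  have hG := cond_GG l hr ht hw
  have hne : ∀ J : Set α, Bg (GG r l) J → J.Nonempty := Bg.ne
  have hsp := Bg.split hG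
  have hspd : ∀ J, Bg (GG r l) J → ∃ J0 J1, Bg (GG r l) J0 ∧ Bg (GG r l) J1 ∧ J0 ⊆ J ∧ J1 ⊆ J ∧
      @LL α (dualLO lo) J0 J1 := by
    intro J hJ
    obtain ⟨J0, J1, h0, h1, h2, h3, h4⟩ := hsp J hJ
    exact ⟨J1, J0, h1, h0, h3, h2, LL.dual.2 h4⟩
  let cls : α → Set α := fun x => {y | y ∈ J ∧ GG r l (btw x y)}
  have hcJ : ∀ x, cls x ⊆ J := fun x y hy => hy.1
  have hcs : ∀ x ∈ J, x ∈ cls x := fun x hx => ⟨hx, hG.rfl' x⟩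
  have hcE : ∀ x y, GG r l (btw x y) → cls x = cls y := by
    intro x y hxy
    ext z
    constructor
    · rintro ⟨h1, h2⟩
      rw [btw_comm] at hxy
      exact ⟨h1, hG.trans hxy h2⟩
    · rintro ⟨h1, h2⟩
      exact ⟨h1, hG.trans hxy h2⟩
  have hcLL : ∀ x y, x < y → ¬ GG r l (btw x y) → LL (cls x) (cls y) := by
    intro x y hxy hn s hs t ht'
    by_contra hc
    rw [not_lt] at hc
    apply hn
    have h1 := hs.2
    have h2 := ht'.2
    rw [btw_comm] at h2
    rcases le_total s y with h3 | h3
    · refine hG.trans h1 (hG.mono _ _ ?_ h2)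
      intro u hu
      rcases hu with hu | hu
      · exact Or.inl ⟨hc.trans hu.1, hu.2⟩
      · exact Or.inl ⟨hc.trans (h3.trans hu.1), hu.2.trans h3⟩
    · refine hG.mono _ _ ?_ h1
      intro u hu
      have := btw_lt hxy hu
      exact Or.inl ⟨this.1, this.2.trans h3⟩
  have hcv : ∀ x, Cv (cls x) := by
    intro x a ha b hb z h1 h2
    refine ⟨hJ.1 a ha.1 b hb.1 z h1 h2, ?_⟩
    have h3 : GG r l (btw a b) := by
      have := ha.2
      rw [btw_comm] at this
      exact hG.trans this hb.2
    refine hG.trans ha.2 (hG.mono _ _ ?_ h3)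
    rintro u (hu | hu)
    · exact Or.inl ⟨hu.1, hu.2.trans h2⟩
    · exact Or.inl ⟨h1.trans hu.1, (hu.2.trans h1).trans h2⟩
  have hFS : ∀ x : J, FS r l (cls x.1) := by
    intro x
    refine hG.pairwise (cls x.1) ?_ _ subset_rfl (hcv x.1)
    intro a ha b hb
    have := ha.2
    rw [btw_comm] at this
    exact hG.trans this hb.2
  choose 𝓜 hM1 hM2 hM3 hM4 using hFS
  choose cd hcd using hM4
  let ι : Type := {p : J × Set α // p.2 ∈ 𝓜 p.1}
  let f : ι → Code Q := fun p => cd p.1.1 p.1.2 p.2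
  let 𝓒 : Set (Set α) := {X | ∃ x : J, X = cls x.1}
  have hCne : ∀ C ∈ 𝓒, C.Nonempty ∧ C ⊆ J := by
    rintro _ ⟨x, rfl⟩
    exact ⟨⟨x.1, hcs x.1 x.2⟩, hcJ _⟩
  have hCE : ∀ C ∈ 𝓒, ∀ C' ∈ 𝓒, ∀ x ∈ C, ∀ y ∈ C', GG r l (btw x y) → C = C' := by
    rintro _ ⟨x, rfl⟩ _ ⟨y, rfl⟩ a ha b hb hab
    rw [hcE _ _ ha.2, hcE _ _ hb.2, hcE _ _ hab]
  refine FinB.single (.node 2 (aO (Bg (GG r l)) J) (@aO α (dualLO lo) (Bg (GG r l)) J) ι f) ⟨?_, ?_⟩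
  · refine ⟨𝓒, ⟨fun C hC => (hCne C hC).1, ?_⟩, ?_, ?_, ?_, ?_, ?_⟩
    · rintro _ ⟨x, rfl⟩ _ ⟨y, rfl⟩
      by_cases h : GG r l (btw x.1 y.1)
      · exact Or.inl (hcE _ _ h)
      · right
        rcases lt_trichotomy x.1 y.1 with h1 | h1 | h1
        · exact Or.inl (hcLL _ _ h1 h)
        · rw [h1] at h
          exact absurd (hG.rfl' _) h
        · rw [btw_comm] at h
          exact Or.inr (hcLL _ _ h1 h)
    · ext y
      constructor
      · rintro ⟨_, ⟨x, rfl⟩, hy⟩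
        exact hy.1
      · intro hy
        exact ⟨cls y, ⟨⟨y, hy⟩, rfl⟩, hcs y hy⟩
    · rintro _ ⟨x, rfl⟩
      exact ⟨𝓜 x, hM1 x, hM2 x, hM3 x, fun M hM => ⟨⟨(x, M), hM⟩, (hcd x M hM).1⟩⟩
    · obtain ⟨A, hA1, hA2⟩ := hα
      refine ⟨fun n => {C | (C ∩ A n).Nonempty}, ?_, ?_⟩
      · intro C hC
        obtain ⟨x, hx⟩ := (hCne C hC).1
        obtain ⟨n, hn⟩ := hA1 x
        exact ⟨n, x, hx, hn⟩
      · rintro n ⟨g, hg1, hg2⟩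
        choose x hx using fun q => (hg1 q).2
        exact hA2 n ⟨fun q => ⟨x q, (hx q).2⟩, fun p q hpq => hg2 p q hpq _ (hx p).1 _ (hx q).1⟩
    · refine aO_noInc hne hsp hJ ha (fun x y => GG r l (btw x y)) ?_ 𝓒 hCne ?_
      · intro x hx y hy hxy hn
        obtain ⟨z, h1, h2, h3, h4⟩ := hG.dense hxy hn
        refine ⟨btw x z, btw_Bg h1 h3, btw_cv hJ.1 hx (hJ.1 x hx y hy z h1.le h2.le), ?_⟩
        intro t ht'
        exact ⟨(btw_lt h1 ht').1, (btw_lt h1 ht').2.trans_lt h2⟩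
      · intro C hC C' hC' hLL x hx y hy hE
        have := hCE C hC C' hC' x hx y hy hE
        rw [← this] at hLL
        exact LL.irrefl (hCne C hC).1 hLL
    · refine @aO_noInc α (dualLO lo) (Bg (GG r l)) hne hspd J hJ hb (fun x y => GG r l (btw x y)) ?_ 𝓒 hCne ?_
      · intro x hx y hy hxy hn
        replace hxy : y < x := hxy
        rw [btw_comm] at hn
        obtain ⟨z, h1, h2, h3, h4⟩ := hG.dense hxy hn
        refine ⟨btw z x, btw_Bg h2 h4, btw_cv hJ.1 (hJ.1 y hy x hx z h1.le h2.le) hx, ?_⟩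
        intro t ht'
        exact ⟨(btw_lt h2 ht').2, h1.trans_le (btw_lt h2 ht').1⟩
      · intro C hC C' hC' hLL x hx y hy hE
        have := hCE C hC C' hC' x hx y hy hE
        rw [← this, LL.dual] at hLL
        exact LL.irrefl (hCne C hC).1 hLL
  · refine ⟨{J' | Bg (GG r l) J' ∧ J' ⊆ J}, ⟨J, ⟨hJ, subset_rfl⟩, subset_rfl⟩, aO_incF hne hsp ha,
      @aO_incF α (dualLO lo) (Bg (GG r l)) hne hspd J hb, ?_⟩
    rintro ⟨⟨x, M⟩, hM⟩ J' ⟨hB, hJ'⟩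
    obtain ⟨J0, J1, h0, h1, h2, h3, h4⟩ := hsp J' hB
    obtain ⟨J2, J3, g0, g1, g2, g3, g4⟩ := hsp J1 h1
    refine ⟨J0, ⟨h0, h2.trans hJ'⟩, J3, ⟨g1, g3.trans (h3.trans hJ')⟩, J2, h2, g3.trans h3, g2.trans h3,
      h4.mono subset_rfl g2, g4, h4.mono subset_rfl g3, ?_⟩
    refine hD J2 (g2.trans (h3.trans hJ')) g0 _ ?_
    refine (hcd x M hM).2.mono (hB := ?_)
    refine subset_trans ?_ (hcJ x.1)
    rw [← hM3 x]
    exact Set.subset_sUnion_of_mem hM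

theorem sigma_FS (hr : Reflexive r) (ht : Transitive r)
    (hw : ∀ e : ℕ → Code Q, ∃ m n, m < n ∧ Le r (e m) (e n)) (hα : IsSigmaScattered α) :
    FS r l (Set.univ : Set α) := by
  have hG := cond_GG l hr ht hw
  suffices h : GG r l (Set.univ : Set α) from h _ subset_rfl (fun _ _ _ _ _ _ _ => trivial)
  refine hG.pairwise _ ?_
  have key : ∀ J, ¬ Bg (GG r l) J := by
    intro J hJ
    obtain ⟨J1, h1, hB1, hm1⟩ := wf_min (Bg (GG r l)) (fun J' J => aO (Bg (GG r l)) J' < aO (Bg (GG r l)) J)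
      (InvImage.wf _ wellFounded_lt) J hJ
    obtain ⟨J2, h2, hB2, hm2⟩ := wf_min (Bg (GG r l)) (fun J' J => @aO α (dualLO lo) (Bg (GG r l)) J' <
      @aO α (dualLO lo) (Bg (GG r l)) J) (InvImage.wf _ wellFounded_lt) J1 hB1
    obtain ⟨J3, h3, hB3, hm3⟩ := wf_min (Bg (GG r l)) _ (dn_wf l ht hw) J2 hB2
    have hne : ∀ J : Set α, Bg (GG r l) J → J.Nonempty := Bg.ne
    have hall : ∀ J' ⊆ J3, Bg (GG r l) J' → FS r l J' := by
      intro J' hJ' hB'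
      refine homog_FS l hr ht hw hα J' hB' ?_ ?_ ?_
      · intro J'' h4 hB'' hlt
        refine hm1 J'' (h4.trans (hJ'.trans (h3.trans h2))) hB'' (hlt.trans_le ?_)
        exact aO_mono hne (hJ'.trans (h3.trans h2))
      · intro J'' h4 hB'' hlt
        refine hm2 J'' (h4.trans (hJ'.trans h3)) hB'' (hlt.trans_le ?_)
        exact @aO_mono α (dualLO lo) (Bg (GG r l)) hne _ _ (hJ'.trans h3)
      · intro J'' h4 hB'' h hd
        by_contra hc
        exact hm3 J'' (h4.trans hJ') hB'' ⟨h4.trans hJ', h, hd.mono (hB := hJ'), hc⟩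
    obtain ⟨hcv, x, hx, y, hy, hxy, hn⟩ := hB3
    apply hn
    intro K hK hKc
    by_cases hKB : Bg (GG r l) K
    · exact hall K (hK.trans (btw_cv hcv hx hy)) hKB
    · refine hG.pairwise K ?_ K subset_rfl hKc
      intro a ha b hb
      by_contra hc
      rcases lt_trichotomy a b with h | h | h
      · exact hKB ⟨hKc, a, ha, b, hb, h, hc⟩
      · rw [h] at hc
        exact hc (hG.rfl' _)
      · rw [btw_comm] at hc
        exact hKB ⟨hKc, b, hb, a, ha, h, hc⟩
  intro x _ y _
  by_contra hc
  rcases lt_trichotomy x y with h | h | h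
  · exact key _ (btw_Bg h hc)
  · rw [h] at hc
    exact hc (hG.rfl' _)
  · rw [btw_comm] at hc
    exact key _ (btw_Bg h hc)

end TSS


namespace TSS

universe u

/-- finite decompositions listed by their codes -/
def ListP {α : Type} [LinearOrder α] {ι : Type*} (P : ι → Set α → Prop) :
    List ι → Set α → Prop
  | [], A => A = ∅
  | h :: s, A => ∃ M N, LL M N ∧ A = M ∪ N ∧ P h M ∧ ListP P s N

section
variable {α : Type} [lo : LinearOrder α] {ι : Type*} {P P' : ι → Set α → Prop}

lemma ListP.append : ∀ (s t : List ι) (A B : Set α), LL A B → ListP P s A → ListP P t B →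
    ListP P (s ++ t) (A ∪ B)
  | [], t, A, B, _, hs, ht => by
    have hA : A = ∅ := hs
    subst hA
    simpa using ht
  | h :: s, t, A, B, hAB, hs, ht => by
    obtain ⟨M, N, h1, rfl, h2, h3⟩ := hs
    refine ⟨M, N ∪ B, ?_, Set.union_assoc _ _ _, h2,
      ListP.append s t N B (hAB.mono Set.subset_union_right subset_rfl) h3 ht⟩
    rintro x hx y (hy | hy)
    · exact h1 x hx y hy
    · exact hAB x (Or.inl hx) y hy

lemma ListP.imp (h : ∀ i A, P i A → P' i A) : ∀ (s : List ι) (A : Set α), ListP P s A →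
    ListP P' s A
  | [], _, hs => hs
  | _ :: s, _, hs => by
    obtain ⟨M, N, h1, h0, h2, h3⟩ := hs
    exact ⟨M, N, h1, h0, h _ _ h2, ListP.imp h s N h3⟩

lemma FinB.list {A : Set α} (h : FinB P A) : ∃ s, ListP P s A := by
  refine h.ind (fun A => ∃ s, ListP P s A) ⟨[], rfl⟩ ?_ ?_
  · rintro A B hAB ⟨s, hs⟩ ⟨t, ht⟩
    exact ⟨s ++ t, ListP.append s t A B hAB hs ht⟩
  · intro i M hM
    exact ⟨[i], M, ∅, fun _ _ _ h => h.elim, (Set.union_empty _).symm, hM, rfl⟩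

end

lemma list_emb {α β : Type} [la : LinearOrder α] [lb : LinearOrder β] {Q : Type u}
    {r : Q → Q → Prop} (ht : Transitive r) (l : α → Q) (l' : β → Q) {s t : List (Code Q)}
    (hst : List.SublistForall₂ (Le r) s t) : ∀ A B, ListP (Up r l) s A → ListP (Dn r l') t B →
    Emb (fun x y => r (l x) (l' y)) A B := by
  induction hst with
  | nil =>
    intro A B hA _
    have hA : A = ∅ := hA
    subst hA
    exact Emb.empty _ _
  | cons h _ ih =>
    rintro A B ⟨M, N, h1, rfl, h2, h3⟩ ⟨M', N', h1', rfl, h2', h3'⟩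
    exact Emb.union h1 h1' (comp ht l l' _ _ _ h2 (Dn.le l' ht h _ h2')) (ih _ _ h3 h3')
  | cons_right _ ih =>
    rintro A B hA ⟨M', N', h1', rfl, h2', h3'⟩
    exact (ih _ _ hA h3').mono Set.subset_union_right

lemma thin_of_DThin {P : Type u} [Countable P] {r : P → P → Prop} (h : DThin.{u} r) :
    IsThin r := by
  letI : MeasurableSpace P := ⊤
  have hinv : ∀ X ∈ vecSet r, seqShift X ∈ vecSet r := fun X hX k => hX (k + 1)
  have hm : Measurable (fun X : vecSet r => (⟨seqShift X.1, hinv _ X.2⟩ : vecSet r)) := by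
    refine Measurable.subtype_mk ?_
    exact measurable_pi_lambda _ fun k => (measurable_pi_apply (k + 1)).comp measurable_subtype_coe
  obtain ⟨c, hc, hcc⟩ := h (vecSet r) _ hm (fun X => X.1 0)
    ⟨Set.to_countable _, fun A => ((measurable_pi_apply 0).comp measurable_subtype_coe) trivial⟩
    (fun X => X.2 0)
  exact ⟨c, hc, fun X hX hX' => (hcc ⟨X, hX⟩ trivial)⟩

lemma DThin.pull.{v, w, w'} {P : Type w} {P' : Type w'} {r : P → P → Prop} {r' : P' → P' → Prop}
    (h : DThin.{v} r) (g : P' → P) (hg : ∀ a b, r (g a) (g b) → r' a b) : DThin.{v} r' :=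
  fun Ω _ S hS φ hφ hn => h Ω S hS (fun ω => g (φ ω)) (hφ.comp g) fun ω hω => hn ω (hg _ _ hω)

end TSS

theorem thin_sigma_scattered {Q : Type*} [Countable Q]
    (r : Q → Q → Prop) (hr : Reflexive r) (ht : Transitive r)
    (hQ : IsThin r)
    (R : Set (Σ α : Type, LinearOrder α × (α → Q))) (hR : R.Countable)
    (hscat : ∀ p ∈ R, letI := p.2.1; IsSigmaScattered p.1) :
    IsThin (fun L₁ L₂ : R =>
      letI := L₁.1.2.1
      letI := L₂.1.2.1
      ∃ f : L₁.1.1 → L₂.1.1, StrictMono f ∧ ∀ x, r (L₁.1.2.2 x) (L₂.1.2.2 (f x))) := by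
  have hw := TSS.DThin.wqo (TSS.DThin.le (TSS.DThin.of_isThin.{0} r hQ))
  have hs : ∀ p : R, ∃ s, @TSS.ListP p.1.1 p.1.2.1 _
      (fun h M => @TSS.Up p.1.1 p.1.2.1 _ r p.1.2.2 h M ∧ @TSS.Dn p.1.1 p.1.2.1 _ r p.1.2.2 h M)
      s Set.univ := by
    intro p
    letI := p.1.2.1
    exact TSS.FinB.list (TSS.sigma_FS p.1.2.2 hr ht hw (hscat p.1 p.2))
  choose s hs using hs
  haveI : Countable R := hR.to_subtype
  refine TSS.thin_of_DThin (TSS.DThin.pull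
    (TSS.DThin.list (TSS.DThin.le (TSS.DThin.of_isThin r hQ))) s ?_)
  intro a b hab
  letI := a.1.2.1
  letI := b.1.2.1
  obtain ⟨f, h1, h2⟩ := TSS.list_emb ht a.1.2.2 b.1.2.2 hab Set.univ Set.univ
    (TSS.ListP.imp (fun _ _ h => h.1) _ _ (hs a)) (TSS.ListP.imp (fun _ _ h => h.2) _ _ (hs b))
  exact ⟨fun x => f ⟨x, trivial⟩, fun x y hxy => h2 _ _ hxy, fun x => (h1 ⟨x, trivial⟩).2⟩
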